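/- arXiv:1210.2545 — 3 statements merged into one kernel-verified Lean document; each statement's English description precedes it below -/
import Mathlib

section
/- Let Ω ⊆ ℝ² be an open, simply connected region, let X = (P,Q) : Ω → ℝ² be a C¹ vector field, and let B : Ω → ℝ be a C¹ function such that div(B·X)(z) = ∂(BP)/∂x (z) + ∂(BQ)/∂y (z) > 0 for every z ∈ Ω. Then the planar differential equation x' = P(x,y), y' = Q(x,y) possesses no periodic orbit that is entirely contained in Ω. -/
open Complex MeasureTheory Set Filter Topology

/-- Twice the Wirtinger derivative `∂g/∂z̄`. -/
noncomputable def dbar (g : ℂ → ℂ) (z : ℂ) : ℂ := fderiv ℝ g z 1 + I * fderiv ℝ g z I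

lemma fderiv_rotate_add (L : ℂ →L[ℝ] ℂ) (θ : ℝ) :
    (L 1 + I * L I) / exp (θ * I) = L (exp (θ * I)) + I * L (I * exp (θ * I)) := by
  have h1 : exp (θ * I) = (Real.cos θ) • (1 : ℂ) + (Real.sin θ) • I := by
    rw [exp_mul_I]; simp
  have h2 : I * exp (θ * I) = (-Real.sin θ) • (1 : ℂ) + (Real.cos θ) • I := by
    rw [exp_mul_I]; simp; ring_nf; simp; ring
  rw [div_eq_iff (exp_ne_zero _), h2, h1]
  rw [map_add, map_add, L.map_smul, L.map_smul, L.map_smul, L.map_smul]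
  simp only [real_smul]
  have h3 : (Real.cos θ : ℂ) ^ 2 + (Real.sin θ : ℂ) ^ 2 = 1 := by
    rw [add_comm]; exact_mod_cast Real.sin_sq_add_cos_sq θ
  push_cast
  push_cast at h3
  linear_combination (-L 1 - I * L I) * h3 + ((sin θ) ^ 2 * L 1 - sin θ * cos θ * L I) * I_sq

lemma integrableOn_polar_target {F : ℝ × ℝ → ℂ} (hF : Continuous F) {R : ℝ}
    (hR : ∀ p : ℝ × ℝ, R < p.1 → F p = 0) :
    IntegrableOn F (Ioi 0 ×ˢ Ioo (-Real.pi) Real.pi) := by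
  have h : IntegrableOn F (Icc 0 R ×ˢ Icc (-Real.pi) Real.pi) :=
    hF.continuousOn.integrableOn_compact (isCompact_Icc.prod isCompact_Icc)
  refine h.of_forall_sdiff_eq_zero (measurableSet_Ioi.prod measurableSet_Ioo) ?_
  rintro p ⟨⟨h1, h2⟩, h3⟩
  apply hR
  by_contra! h4
  exact h3 ⟨⟨le_of_lt h1, h4⟩, Ioo_subset_Icc_self h2⟩

/-- The Cauchy–Pompeiu formula for compactly supported functions. -/
theorem integral_dbar_div {g : ℂ → ℂ} (hg : ContDiff ℝ 1 g) (hc : HasCompactSupport g) (ζ : ℂ) :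
    ∫ w, dbar g (ζ + w) / w = -(2 * Real.pi) * g ζ := by
  have hdiff : Differentiable ℝ g := hg.differentiable one_ne_zero
  have hcd : Continuous (fderiv ℝ g) := hg.continuous_fderiv one_ne_zero
  obtain ⟨R, hR⟩ : ∃ R : ℝ, 0 ≤ R ∧ ∀ w : ℂ, R < ‖w‖ → ζ + w ∉ tsupport g := by
    obtain ⟨R, hR⟩ := hc.isCompact.isBounded.subset_closedBall ζ
    refine ⟨max R 0, le_max_right _ _, fun w hw hmem => ?_⟩
    have := hR hmem
    simp at this
    exact absurd (lt_of_le_of_lt (le_max_left _ _) hw) (not_lt.mpr this)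
  have hzero : ∀ (r θ : ℝ), R < r → ζ + r * exp (θ * I) ∉ tsupport g := fun r θ hr =>
    hR.2 _ (by simpa [norm_exp_ofReal_mul_I] using lt_of_lt_of_le hr (le_abs_self r))
  have hzero' : ∀ (r θ : ℝ), R < r → fderiv ℝ g (ζ + r * exp (θ * I)) = 0 := fun r θ hr =>
    image_eq_zero_of_notMem_tsupport fun h => hzero r θ hr (tsupport_fderiv_subset ℝ h)
  set F₁ : ℝ × ℝ → ℂ := fun p => fderiv ℝ g (ζ + p.1 * exp (p.2 * I)) (exp (p.2 * I)) with hF₁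
  set F₂ : ℝ × ℝ → ℂ :=
    fun p => I * fderiv ℝ g (ζ + p.1 * exp (p.2 * I)) (I * exp (p.2 * I)) with hF₂
  have hF₁c : Continuous F₁ := by fun_prop
  have hF₂c : Continuous F₂ := by fun_prop
  have hi₁ := integrableOn_polar_target hF₁c (R := R)
    (fun p hp => by simp [hF₁, hzero' p.1 p.2 hp])
  have hi₂ := integrableOn_polar_target hF₂c (R := R)
    (fun p hp => by simp [hF₂, hzero' p.1 p.2 hp])
  have hI₁ : ∀ θ : ℝ, ∫ r in Ioi 0, F₁ (r, θ) = -g ζ := by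
    intro θ
    have hder : ∀ r : ℝ, HasDerivAt (fun r : ℝ => g (ζ + r * exp (θ * I))) (F₁ (r, θ)) r := by
      intro r
      refine (hdiff _).hasFDerivAt.comp_hasDerivAt r ?_
      simpa using ((ofRealCLM.hasDerivAt (x := r)).mul_const (exp (θ * I))).const_add ζ
    have h := HasCompactSupport.integral_Ioi_deriv_eq
      (f := fun r : ℝ => g (ζ + r * exp (θ * I)))
      (hg.comp (contDiff_const.add (ofRealCLM.contDiff.mul contDiff_const)))
      (HasCompactSupport.intro (isCompact_Icc (a := -R) (b := R)) fun r hr => by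
        apply image_eq_zero_of_notMem_tsupport
        refine hR.2 _ ?_
        simp only [norm_mul, norm_exp_ofReal_mul_I, norm_real, mul_one, Real.norm_eq_abs]
        by_contra! h
        exact hr (abs_le.mp h)) 0
    simp only [(hder _).deriv] at h
    simpa using h
  have hI₂ : ∀ r ∈ Ioi (0 : ℝ), ∫ θ in Ioo (-Real.pi) Real.pi, F₂ (r, θ) = 0 := by
    intro r hr
    have hder : ∀ θ : ℝ,
        HasDerivAt (fun θ : ℝ => (I / r) * g (ζ + r * exp (θ * I))) (F₂ (r, θ)) θ := by
      intro θ
      have h1 : HasDerivAt (fun θ : ℝ => ζ + r * exp (θ * I)) (r • (I * exp (θ * I))) θ := by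
        have := ((((ofRealCLM.hasDerivAt (x := θ)).mul_const I).cexp).const_mul (r : ℂ)).const_add ζ
        refine this.congr_deriv ?_
        simp [mul_comm]
      have h2 := ((hdiff (ζ + r * exp (θ * I))).hasFDerivAt.comp_hasDerivAt θ h1).const_mul (I / r)
      refine h2.congr_deriv ?_
      have : (r : ℂ) ≠ 0 := by exact_mod_cast (ne_of_gt hr)
      rw [ContinuousLinearMap.map_smul, real_smul]
      simp only [hF₂]
      field_simp
    rw [← integral_Ioc_eq_integral_Ioo,
      ← intervalIntegral.integral_of_le (by linarith [Real.pi_pos])]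
    rw [intervalIntegral.integral_eq_sub_of_hasDerivAt (fun θ _ => hder θ)
      ((hF₂c.comp (by fun_prop : Continuous fun θ : ℝ => (r, θ))).intervalIntegrable _ _)]
    simp [exp_neg]
  rw [← Complex.integral_comp_polarCoord_symm]
  have hsplit : ∫ p in polarCoord.target, p.1 • (dbar g (ζ + Complex.polarCoord.symm p) /
      Complex.polarCoord.symm p) = ∫ p in Ioi 0 ×ˢ Ioo (-Real.pi) Real.pi, (F₁ p + F₂ p) := by
    refine setIntegral_congr_fun (measurableSet_Ioi.prod measurableSet_Ioo) ?_
    rintro ⟨r, θ⟩ ⟨hr, -⟩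
    have hr' : (r : ℂ) ≠ 0 := by exact_mod_cast (ne_of_gt hr)
    have : Complex.polarCoord.symm (r, θ) = r * exp (θ * I) := by
      rw [Complex.polarCoord_symm_apply, exp_mul_I]; simp
    simp only [this, hF₁, hF₂, ← fderiv_rotate_add, dbar, real_smul]
    field_simp
  rw [hsplit, integral_add hi₁ hi₂, Measure.volume_eq_prod]
  rw [Measure.volume_eq_prod] at hi₁ hi₂
  rw [setIntegral_prod _ hi₂, setIntegral_congr_fun measurableSet_Ioi hI₂,
    ← setIntegral_prod_swap, show (∫ z in Ioo (-Real.pi) Real.pi ×ˢ Ioi 0, F₁ z.swap ∂volume.prod volume) = _ from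
      setIntegral_prod _ hi₁.swap]
  have hpi : max (Real.pi + Real.pi) 0 = Real.pi + Real.pi := max_eq_left (by positivity)
  simp only [Prod.swap_prod_mk, hI₁]
  simp [hpi]
  ring_nf
  simp

/-- The Cauchy integral `∮ dζ / (ζ - z)` along `γ` restricted to `[0, T]`. -/
noncomputable def cauchyLoop (γ : ℝ → ℂ) (T : ℝ) (z : ℂ) : ℂ :=
  ∫ t in (0 : ℝ)..T, deriv γ t / (γ t - z)

section
variable {γ : ℝ → ℂ} {T : ℝ} {z : ℂ}

lemma continuous_deriv_div_sub (hγ : ContDiff ℝ 1 γ) (hz : z ∉ range γ) :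
    Continuous fun t => deriv γ t / (γ t - z) :=
  (hγ.continuous_deriv le_rfl).div (hγ.continuous.sub continuous_const)
    fun t h => hz ⟨t, sub_eq_zero.mp h⟩

lemma cauchyLoop_eq_sub_of_exp_eq (hγ : ContDiff ℝ 1 γ) (hz : z ∉ range γ) {l : ℝ → ℂ}
    (hl : Continuous l) (hexp : ∀ t, exp (l t) = γ t - z) :
    cauchyLoop γ T z = l T - l 0 := by
  refine intervalIntegral.integral_eq_sub_of_hasDerivAt (fun t _ => ?_)
    ((continuous_deriv_div_sub hγ hz).intervalIntegrable _ _)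
  have hne : γ t - z ≠ 0 := fun h => hz ⟨t, sub_eq_zero.mp h⟩
  have hs : HasStrictDerivAt exp (γ t - z) (l t) := hexp t ▸ hasStrictDerivAt_exp (l t)
  have hinv := (hs.to_localInverse hne).hasDerivAt
  rw [hexp] at hinv
  have hcomp := hinv.scomp t (((hγ.differentiable one_ne_zero) t).hasDerivAt.sub_const z)
  refine (hcomp.congr_deriv ?_).congr_of_eventuallyEq ?_
  · simp [div_eq_mul_inv]
  · filter_upwards [hl.continuousAt.eventually
      ((hs.hasStrictFDerivAt_equiv hne).eventually_left_inverse)] with s hs'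
    rw [hexp] at hs'
    exact hs'.symm

lemma exists_cauchyLoop_eq_int_mul (hγ : ContDiff ℝ 1 γ) (hT : γ T = γ 0) (hz : z ∉ range γ) :
    ∃ k : ℤ, cauchyLoop γ T z = k * (2 * Real.pi * I) := by
  have hc := continuous_deriv_div_sub hγ hz
  have hne : ∀ t, γ t - z ≠ 0 := fun t h => hz ⟨t, sub_eq_zero.mp h⟩
  have hder : ∀ t, HasDerivAt
      (fun t => (γ t - z) * exp (-∫ s in (0 : ℝ)..t, deriv γ s / (γ s - z))) 0 t := by
    intro t
    have h1 := ((hγ.differentiable one_ne_zero) t).hasDerivAt.sub_const z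
    have h2 := (hc.integral_hasStrictDerivAt 0 t).hasDerivAt.fun_neg.cexp
    refine (h1.mul h2).congr_deriv ?_
    have := hne t
    field_simp
    ring
  have hconst := is_const_of_deriv_eq_zero (fun t => (hder t).differentiableAt)
    (fun t => (hder t).deriv) T 0
  simp only [intervalIntegral.integral_same, neg_zero, exp_zero, hT] at hconst
  have h3 : exp (-cauchyLoop γ T z) = 1 := mul_left_cancel₀ (hne 0) hconst
  rw [exp_neg, inv_eq_one, exp_eq_one_iff] at h3
  exact h3

lemma continuousOn_cauchyLoop (hγ : ContDiff ℝ 1 γ) (hcl : IsClosed (range γ)) :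
    ContinuousOn (cauchyLoop γ T) (range γ)ᶜ := by
  have hd := hγ.continuous_deriv le_rfl
  intro z₀ hz₀
  refine ContinuousAt.continuousWithinAt ?_
  obtain ⟨ε, hε, hball⟩ := Metric.isOpen_iff.mp hcl.isOpen_compl z₀ hz₀
  have hev : ∀ᶠ z in 𝓝 z₀, ∀ t, ε / 2 ≤ ‖γ t - z‖ := by
    filter_upwards [Metric.ball_mem_nhds z₀ (half_pos hε)] with z hz t
    have h1 : ε ≤ dist (γ t) z₀ := by
      by_contra! h
      exact hball h ⟨t, rfl⟩
    rw [← dist_eq_norm]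
    have := dist_triangle (γ t) z z₀
    have h2 : dist z z₀ < ε / 2 := hz
    linarith
  refine intervalIntegral.continuousAt_of_dominated_interval
    (bound := fun t => ‖deriv γ t‖ / (ε / 2)) ?_ ?_ ?_ ?_
  · filter_upwards [hcl.isOpen_compl.mem_nhds hz₀] with z hz
    exact (continuous_deriv_div_sub hγ hz).aestronglyMeasurable
  · filter_upwards [hev] with z hz
    refine Eventually.of_forall fun t _ => ?_
    rw [norm_div]
    gcongr
    exact hz t
  · exact (hd.norm.div_const _).intervalIntegrable _ _
  · refine Eventually.of_forall fun t _ => ?_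
    exact continuousAt_const.div (by fun_prop) fun h => hz₀ ⟨t, sub_eq_zero.mp h⟩

lemma cauchyLoop_eq_zero_of_bound_lt (hγ : ContDiff ℝ 1 γ) (hT : γ T = γ 0) {R : ℝ}
    (hR : ∀ t, ‖γ t‖ ≤ R) (hz : R < ‖z‖) : z ∉ range γ ∧ cauchyLoop γ T z = 0 := by
  have hz' : z ∉ range γ := by
    rintro ⟨t, rfl⟩
    exact absurd (hR t) (not_le.mpr hz)
  have hzpos : 0 < ‖z‖ := ((norm_nonneg _).trans (hR 0)).trans_lt hz
  have hz0 : z ≠ 0 := norm_pos_iff.mp hzpos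
  have hsl : ∀ t, 1 + (-(γ t / z)) ∈ slitPlane := fun t =>
    mem_slitPlane_of_norm_lt_one (by
      rw [norm_neg, norm_div, div_lt_one hzpos]
      exact (hR t).trans_lt hz)
  have hcont : Continuous fun t => log (1 + (-(γ t / z))) + log (-z) :=
    ((by have := hγ.continuous; fun_prop : Continuous fun t => 1 + (-(γ t / z))).clog hsl).add
      continuous_const
  refine ⟨hz', ?_⟩
  rw [cauchyLoop_eq_sub_of_exp_eq hγ hz' hcont fun t => ?_]
  · simp [hT]
  · rw [exp_add, exp_log (slitPlane_ne_zero (hsl t)), exp_log (neg_ne_zero.mpr hz0)]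
    field_simp
    ring

end

lemma integrable_indicator_ball_inv_norm (R : ℝ) :
    Integrable ((Metric.ball (0 : ℂ) R).indicator fun w => ‖w‖⁻¹) := by
  rw [integrable_indicator_iff Metric.isOpen_ball.measurableSet]
  refine (integrableOn_fun_norm_addHaar (E := ℂ) volume (f := fun x : ℝ => x⁻¹)).mpr ?_
  refine (integrableOn_const (C := (1 : ℝ)) (s := Ioo 0 R) (by simp)).congr_fun ?_ measurableSet_Ioo
  intro y hy
  have : y ≠ 0 := hy.1.ne'
  simp [Complex.finrank_real_complex, this]

lemma integrable_translates {k : ℂ → ℝ} (hk : Integrable k) (hm : Measurable k) {γ : ℝ → ℂ}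
    (hγ : Continuous γ) (T : ℝ) :
    Integrable (fun p : ℝ × ℂ => k (p.2 - γ p.1))
      ((volume.restrict (Ioc 0 T)).prod volume) := by
  have hmeas : Measurable fun p : ℝ × ℂ => k (p.2 - γ p.1) :=
    hm.comp (by have := hγ.measurable; fun_prop)
  rw [integrable_prod_iff hmeas.aestronglyMeasurable]
  refine ⟨Eventually.of_forall fun t => hk.comp_sub_right (γ t), ?_⟩
  simp only [integral_sub_right_eq_self (fun z => ‖k z‖) (γ _)]
  exact integrable_const _

lemma integrable_cauchy_kernel {h : ℂ → ℂ} (hh : Continuous h) (hc : HasCompactSupport h)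
    {γ : ℝ → ℂ} (hγ : ContDiff ℝ 1 γ) (T : ℝ) :
    Integrable (fun p : ℝ × ℂ => deriv γ p.1 * (h p.2 / (γ p.1 - p.2)))
      ((volume.restrict (Ioc 0 T)).prod volume) := by
  have hd := hγ.continuous_deriv le_rfl
  obtain ⟨M, hM⟩ := (isCompact_Icc (a := 0) (b := T)).exists_bound_of_continuousOn hd.continuousOn
  obtain ⟨N, hN⟩ :=
    (isCompact_Icc (a := 0) (b := T)).exists_bound_of_continuousOn hγ.continuous.continuousOn
  obtain ⟨H, hH⟩ := hc.exists_bound_of_continuous hh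
  obtain ⟨S, hS⟩ := hc.isCompact.isBounded.subset_ball 0
  have hk := integrable_indicator_ball_inv_norm (S + N)
  have hkm : Measurable ((Metric.ball (0 : ℂ) (S + N)).indicator fun w => ‖w‖⁻¹) :=
    (measurable_norm.inv).indicator Metric.isOpen_ball.measurableSet
  refine ((integrable_translates hk hkm hγ.continuous T).const_mul (M * H)).mono' ?_ ?_
  · have h1 := hγ.continuous.measurable
    have h2 := hd.measurable
    have h3 := hh.measurable
    exact Measurable.aestronglyMeasurable (by fun_prop)
  · have hae : ∀ᵐ p : ℝ × ℂ ∂((volume.restrict (Ioc 0 T)).prod volume), p.1 ∈ Ioc 0 T :=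
      Measure.quasiMeasurePreserving_fst.ae (ae_restrict_mem measurableSet_Ioc)
    filter_upwards [hae] with p hp
    have hp' := Ioc_subset_Icc_self hp
    have hM0 : 0 ≤ M := (norm_nonneg _).trans (hM _ hp')
    have hH0 : 0 ≤ H := (norm_nonneg _).trans (hH 0)
    by_cases hz : p.2 ∈ tsupport h
    · have hmem : p.2 - γ p.1 ∈ Metric.ball (0 : ℂ) (S + N) := by
        rw [mem_ball_zero_iff]
        have := mem_ball_zero_iff.mp (hS hz)
        linarith [norm_sub_le p.2 (γ p.1), hN _ hp']
      rw [indicator_of_mem hmem, norm_mul, norm_div, div_eq_mul_inv, norm_sub_rev, mul_assoc]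
      have := hM _ hp'
      have := hH p.2
      gcongr
    · rw [image_eq_zero_of_notMem_tsupport hz]
      simp only [zero_div, mul_zero, norm_zero]
      exact mul_nonneg (mul_nonneg hM0 hH0) (indicator_nonneg (fun w _ => by positivity) _)

/-- Green's formula for a closed curve: the line integral of `g dζ` is the integral of `∂g/∂z̄`
weighted by the winding number. -/
theorem intervalIntegral_mul_deriv_eq {g : ℂ → ℂ} (hg : ContDiff ℝ 1 g) (hc : HasCompactSupport g)
    {γ : ℝ → ℂ} (hγ : ContDiff ℝ 1 γ) {T : ℝ} (hT : 0 ≤ T) :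
    2 * Real.pi * ∫ t in (0 : ℝ)..T, g (γ t) * deriv γ t = ∫ z, dbar g z * cauchyLoop γ T z := by
  have hcd : Continuous (fderiv ℝ g) := hg.continuous_fderiv one_ne_zero
  have hh : Continuous (dbar g) := by unfold dbar; fun_prop
  have hhc : HasCompactSupport (dbar g) := by
    refine hc.mono' fun z hz => ?_
    by_contra h
    have h0 := image_eq_zero_of_notMem_tsupport fun h' => h (tsupport_fderiv_subset ℝ h')
    exact hz (by simp [dbar, h0])
  have hpt : ∀ t, 2 * Real.pi * (g (γ t) * deriv γ t) =
      ∫ z, deriv γ t * (dbar g z / (γ t - z)) := by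
    intro t
    have h1 := integral_dbar_div hg hc (γ t)
    rw [← integral_sub_right_eq_self _ (γ t)] at h1
    simp only [add_sub_cancel] at h1
    rw [integral_const_mul]
    have h2 : ∀ z, dbar g z / (γ t - z) = -(dbar g z / (z - γ t)) := fun z => by
      rw [← neg_sub z, div_neg]
    simp_rw [h2]
    rw [integral_neg, h1]
    ring
  rw [← intervalIntegral.integral_const_mul]
  simp_rw [hpt]
  rw [intervalIntegral.integral_of_le hT,
    integral_integral_swap (integrable_cauchy_kernel hh hhc hγ T)]
  refine integral_congr_ae (Eventually.of_forall fun z => ?_)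
  simp only [cauchyLoop]
  rw [intervalIntegral.integral_of_le hT, ← integral_const_mul]
  congr 1 with t
  ring

lemma volume_range_eq_zero {γ : ℝ → ℂ} (hγ : Differentiable ℝ γ) : volume (range γ) = 0 := by
  have himage : range γ = (fun z : ℂ => γ z.re) '' (LinearMap.ker imLm : Submodule ℝ ℂ) := by
    ext w
    constructor
    · rintro ⟨t, rfl⟩
      exact ⟨t, by simp, by simp⟩
    · rintro ⟨z, -, rfl⟩
      exact ⟨z.re, rfl⟩
  rw [himage]
  refine addHaar_image_eq_zero_of_differentiableOn_of_addHaar_eq_zero volume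
    (hγ.comp reCLM.differentiable).differentiableOn
    (Measure.addHaar_submodule _ _ fun h => ?_)
  have : I ∈ LinearMap.ker imLm := h ▸ Submodule.mem_top
  simp at this

lemma cauchyLoop_eq_of_isPreconnected {γ : ℝ → ℂ} {T : ℝ} (hγ : ContDiff ℝ 1 γ)
    (hT : γ T = γ 0) (hcl : IsClosed (range γ)) {S : Set ℂ} (hS : IsPreconnected S)
    (hd : S ⊆ (range γ)ᶜ) {z w : ℂ} (hz : z ∈ S) (hw : w ∈ S) :
    cauchyLoop γ T z = cauchyLoop γ T w := by
  have hdisc : IsDiscrete ((AddSubgroup.zmultiples (2 * Real.pi * I) : Set ℂ)) :=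
    ⟨NormedSpace.discreteTopology_zmultiples _⟩
  refine hS.constant_of_mapsTo hdisc
    ((continuousOn_cauchyLoop hγ hcl).mono hd) (fun v hv => ?_) hz hw
  obtain ⟨k, hk⟩ := exists_cauchyLoop_eq_int_mul hγ hT (hd hv)
  exact ⟨k, by simp [hk]⟩

lemma eventually_cauchyLoop_eq {γ : ℝ → ℂ} {T : ℝ} {z : ℂ} (hγ : ContDiff ℝ 1 γ)
    (hT : γ T = γ 0) (hcl : IsClosed (range γ)) (hz : z ∉ range γ) :
    ∀ᶠ w in 𝓝 z, w ∉ range γ ∧ cauchyLoop γ T w = cauchyLoop γ T z := by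
  obtain ⟨ε, hε, hball⟩ := Metric.isOpen_iff.mp hcl.isOpen_compl z hz
  filter_upwards [Metric.ball_mem_nhds z hε] with w hw
  exact ⟨hball hw, cauchyLoop_eq_of_isPreconnected hγ hT hcl (convex_ball z ε).isPreconnected
    hball hw (Metric.mem_ball_self hε)⟩

lemma isOpen_cauchyLoop_ne_zero {γ : ℝ → ℂ} {T : ℝ} (hγ : ContDiff ℝ 1 γ)
    (hcl : IsClosed (range γ)) :
    IsOpen {z | z ∉ range γ ∧ cauchyLoop γ T z ≠ 0} :=
  (continuousOn_cauchyLoop hγ hcl).isOpen_inter_preimage hcl.isOpen_compl isOpen_compl_singleton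

lemma isCompact_range_union_cauchyLoop_ne_zero {γ : ℝ → ℂ} (hγ : ContDiff ℝ 1 γ) {T : ℝ}
    (hloop : γ T = γ 0) (hcomp : IsCompact (range γ)) :
    IsCompact (range γ ∪ {z | z ∉ range γ ∧ cauchyLoop γ T z ≠ 0}) := by
  have hcl := hcomp.isClosed
  obtain ⟨R, hR⟩ := hcomp.isBounded.exists_norm_le
  refine (isCompact_closedBall (0 : ℂ) R).of_isClosed_subset ?_ ?_
  · rw [← isOpen_compl_iff, isOpen_iff_eventually]
    intro z hz
    have hz1 : z ∉ range γ := fun h => hz (Or.inl h)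
    have hz2 : cauchyLoop γ T z = 0 := by
      by_contra h
      exact hz (Or.inr ⟨hz1, h⟩)
    filter_upwards [eventually_cauchyLoop_eq hγ hloop hcl hz1] with w hw
    rintro (h | h)
    · exact hw.1 h
    · exact h.2 (hw.2.trans hz2)
  · intro z hz
    rw [mem_closedBall_zero_iff]
    by_contra! h
    have := cauchyLoop_eq_zero_of_bound_lt hγ hloop (fun t => hR _ ⟨t, rfl⟩) h
    exact hz.elim this.1 fun h' => h'.2 this.2

lemma exists_cutoff {Ω K : Set ℂ} (hΩ : IsOpen Ω) (hK : IsCompact K) (hKΩ : K ⊆ Ω) {g : ℂ → ℂ}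
    (hg : ContDiffOn ℝ 1 g Ω) :
    ∃ g' : ℂ → ℂ, ContDiff ℝ 1 g' ∧ HasCompactSupport g' ∧ EqOn g' g K := by
  obtain ⟨V, hV, hKV, hVΩ, hVc⟩ := exists_open_between_and_isCompact_closure hK hΩ hKΩ
  obtain ⟨χ, hχ, -, hsupp, hone⟩ := exists_contMDiff_support_eq_eq_one_iff (n := 1)
    (modelWithCornersSelf ℝ ℂ) hV hK.isClosed hKV
  have hχ' : ContDiff ℝ 1 χ := hχ.contDiff
  refine ⟨fun z => χ z • g z, contDiff_iff_contDiffAt.mpr fun z => ?_, ?_, fun z hz => ?_⟩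
  · by_cases hz : z ∈ Ω
    · exact hχ'.contDiffAt.smul (hg.contDiffAt (hΩ.mem_nhds hz))
    · have hz' : z ∉ tsupport χ := fun h => hz (hVΩ (by rwa [tsupport, hsupp] at h))
      refine (contDiffAt_const (c := (0 : ℂ))).congr_of_eventuallyEq ?_
      filter_upwards [notMem_tsupport_iff_eventuallyEq.mp hz'] with w hw
      simp [hw]
  · have : HasCompactSupport χ := by rwa [HasCompactSupport, tsupport, hsupp]
    exact this.smul_right
  · simp [(hone z).mp hz]

/-- Green's formula for a closed curve in an open set outside of which its winding number
vanishes. -/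
theorem intervalIntegral_mul_deriv_eq_setIntegral {Ω : Set ℂ} (hΩ : IsOpen Ω) {g : ℂ → ℂ}
    (hg : ContDiffOn ℝ 1 g Ω) {γ : ℝ → ℂ} (hγ : ContDiff ℝ 1 γ) {T : ℝ} (hT : 0 ≤ T)
    (hloop : γ T = γ 0) (hcomp : IsCompact (range γ)) (hγΩ : range γ ⊆ Ω)
    (hW : ∀ z ∉ Ω, cauchyLoop γ T z = 0) :
    2 * Real.pi * ∫ t in (0 : ℝ)..T, g (γ t) * deriv γ t =
      ∫ z in {z | z ∉ range γ ∧ cauchyLoop γ T z ≠ 0}, dbar g z * cauchyLoop γ T z := by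
  have hcl := hcomp.isClosed
  have hU := isOpen_cauchyLoop_ne_zero (T := T) hγ hcl
  set U := {z | z ∉ range γ ∧ cauchyLoop γ T z ≠ 0} with hUdef
  have hKc := isCompact_range_union_cauchyLoop_ne_zero hγ hloop hcomp
  have hKΩ : range γ ∪ U ⊆ Ω :=
    union_subset hγΩ fun z hz => by_contra fun h => hz.2 (hW z h)
  obtain ⟨g', hg', hc', heq⟩ := exists_cutoff hΩ hKc hKΩ hg
  have h1 : ∀ t, g (γ t) = g' (γ t) := fun t => (heq (Or.inl ⟨t, rfl⟩)).symm
  simp_rw [h1]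
  rw [intervalIntegral_mul_deriv_eq hg' hc' hγ hT, ← integral_indicator hU.measurableSet]
  refine integral_congr_ae ?_
  have hnull : ∀ᵐ z : ℂ, z ∉ range γ :=
    measure_eq_zero_iff_ae_notMem.mp (volume_range_eq_zero (hγ.differentiable one_ne_zero))
  filter_upwards [hnull] with z hz
  by_cases hzU : z ∈ U
  · have : g' =ᶠ[𝓝 z] g := by
      filter_upwards [hU.mem_nhds hzU] with w hw using heq (Or.inr hw)
    rw [indicator_of_mem hzU]
    simp only [dbar, this.fderiv_eq]
  · rw [indicator_of_notMem hzU]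
    have : cauchyLoop γ T z = 0 := by
      by_contra h
      exact hzU ⟨hz, h⟩
    simp [this]

section
variable {X : ℂ → ℂ} {Ω : Set ℂ}

lemma integralCurve_unique (hΩ : IsOpen Ω) (hX : ContDiffOn ℝ 1 X Ω) {γ δ : ℝ → ℂ}
    (hγ : ∀ t, HasDerivAt γ (X (γ t)) t) (hδ : ∀ t, HasDerivAt δ (X (δ t)) t)
    (hγΩ : ∀ t, γ t ∈ Ω) {s : ℝ} (hs : γ s = δ s) : γ = δ := by
  have hγc : Continuous γ := continuous_iff_continuousAt.mpr fun t => (hγ t).continuousAt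
  have hδc : Continuous δ := continuous_iff_continuousAt.mpr fun t => (hδ t).continuousAt
  have hclopen : IsClopen {t | γ t = δ t} := by
    refine ⟨isClosed_eq hγc hδc, isOpen_iff_eventually.mpr fun t ht => ?_⟩
    obtain ⟨K, N, hN, hK⟩ :=
      (hX.contDiffAt (hΩ.mem_nhds (hγΩ t))).exists_lipschitzOnWith
    refine ODE_solution_unique_of_eventually (v := fun _ => X) (s := fun _ => N) (K := K)
      (Eventually.of_forall fun _ => hK) ?_ ?_ ht
    · filter_upwards [hγc.continuousAt hN] with r hr using ⟨hγ r, hr⟩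
    · have ht' : γ t = δ t := ht
      rw [ht'] at hN
      filter_upwards [hδc.continuousAt hN] with r hr using ⟨hδ r, hr⟩
  have huniv := hclopen.eq_univ ⟨s, hs⟩
  funext t
  exact huniv.symm.subset (mem_univ t)

variable {γ : ℝ → ℂ}

lemma integralCurve_contDiff (hΩ : IsOpen Ω) (hX : ContDiffOn ℝ 1 X Ω)
    (hγ : ∀ t, HasDerivAt γ (X (γ t)) t) (hγΩ : ∀ t, γ t ∈ Ω) :
    ContDiff ℝ 1 γ ∧ ContDiff ℝ 1 (X ∘ γ) := by
  have hγc : Continuous γ := continuous_iff_continuousAt.mpr fun t => (hγ t).continuousAt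
  have hd : deriv γ = X ∘ γ := funext fun t => (hγ t).deriv
  have h1 : ContDiff ℝ 1 γ := by
    rw [contDiff_one_iff_deriv, hd]
    exact ⟨fun t => (hγ t).differentiableAt, hX.continuousOn.comp_continuous hγc hγΩ⟩
  exact ⟨h1, contDiff_iff_contDiffAt.mpr fun t =>
    (hX.contDiffAt (hΩ.mem_nhds (hγΩ t))).comp t h1.contDiffAt⟩

lemma integralCurve_ne_zero (hΩ : IsOpen Ω) (hX : ContDiffOn ℝ 1 X Ω)
    (hγ : ∀ t, HasDerivAt γ (X (γ t)) t) (hγΩ : ∀ t, γ t ∈ Ω) (hne : ∃ t₁ t₂, γ t₁ ≠ γ t₂) (t : ℝ) :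
    X (γ t) ≠ 0 := by
  intro h
  obtain ⟨t₁, t₂, h12⟩ := hne
  have := integralCurve_unique hΩ hX (δ := fun _ => γ t) hγ
    (fun s => by rw [h]; exact hasDerivAt_const _ _) hγΩ rfl
  exact h12 (by rw [this])

/-- A periodic orbit does not accumulate on itself. -/
lemma eventually_mem_range_imp (hΩ : IsOpen Ω) (hX : ContDiffOn ℝ 1 X Ω)
    (hγ : ∀ t, HasDerivAt γ (X (γ t)) t) (hγΩ : ∀ t, γ t ∈ Ω) {T : ℝ} (hT : 0 < T)
    (hper : Function.Periodic γ T) (t₀ : ℝ) {r : ℝ} (hr : 0 < r) :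
    ∀ᶠ z in 𝓝 (γ t₀), z ∈ range γ → ∃ t, |t - t₀| < r ∧ γ t = z := by
  have hγc : Continuous γ := continuous_iff_continuousAt.mpr fun t => (hγ t).continuousAt
  set K : Set ℝ := Icc 0 T ∩ {t | ∀ s, γ s = γ t₀ → r ≤ |t - s|} with hK
  have hKc : IsCompact K := by
    refine isCompact_Icc.inter_right ?_
    simp only [ofPred_forall]
    exact isClosed_iInter fun s => isClosed_iInter fun _ =>
      isClosed_le continuous_const (by fun_prop)
  have hmem : γ t₀ ∉ γ '' K := by
    rintro ⟨t, ht, hteq⟩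
    have := ht.2 t hteq
    simp at this
    linarith
  filter_upwards [(hKc.image hγc).isClosed.isOpen_compl.mem_nhds hmem]
  rintro z hz ⟨u, rfl⟩
  obtain ⟨t, ht, htu⟩ := hper.exists_mem_Ico₀ hT u
  have htK : t ∉ K := fun h => hz ⟨t, h, htu.symm⟩
  have : ∃ s, γ s = γ t₀ ∧ |t - s| < r := by
    by_contra! h
    exact htK ⟨Ico_subset_Icc_self ht, h⟩
  obtain ⟨s, hs, hts⟩ := this
  have hshift := integralCurve_unique hΩ hX (γ := γ) (δ := fun v => γ (v + (s - t₀))) (s := t₀) hγ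
    (fun v => (hγ (v + (s - t₀))).comp_add_const v (s - t₀)) hγΩ (by simp [hs])
  refine ⟨t - (s - t₀), by ring_nf at hts ⊢; exact hts, ?_⟩
  calc γ (t - (s - t₀)) = γ (t - (s - t₀) + (s - t₀)) := congrFun hshift _
    _ = γ u := by rw [sub_add_cancel, htu]

/-- Normal coordinates along a curve with velocity field `X`. -/
noncomputable def normalMap (X : ℂ → ℂ) (γ : ℝ → ℂ) (p : ℝ × ℝ) : ℂ :=
  γ p.1 + p.2 • (I * X (γ p.1))

lemma normalMap_hasStrictFDerivAt (hΩ : IsOpen Ω) (hX : ContDiffOn ℝ 1 X Ω)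
    (hγ : ∀ t, HasDerivAt γ (X (γ t)) t) (hγΩ : ∀ t, γ t ∈ Ω) (t₀ : ℝ) (hne : X (γ t₀) ≠ 0) :
    ∃ L : (ℝ × ℝ) ≃L[ℝ] ℂ, HasStrictFDerivAt (normalMap X γ) (L : ℝ × ℝ →L[ℝ] ℂ) (t₀, 0) := by
  obtain ⟨h1, h2⟩ := integralCurve_contDiff hΩ hX hγ hγΩ
  have hc : ContDiff ℝ 1 (normalMap X γ) :=
    (h1.comp contDiff_fst).add (contDiff_snd.smul (contDiff_const.mul (h2.comp contDiff_fst)))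
  refine ⟨equivRealProdCLM.symm.trans (ContinuousLinearEquiv.smulLeft (Units.mk0 _ hne)), ?_⟩
  have hd1 : HasFDerivAt (fun p : ℝ × ℝ => γ p.1) _ (t₀, 0) :=
    (hγ t₀).hasFDerivAt.comp (t₀, (0 : ℝ)) hasFDerivAt_fst
  have hd2 : HasFDerivAt (fun p : ℝ × ℝ => I * X (γ p.1)) _ (t₀, 0) :=
    ((contDiff_const.mul (h2.comp contDiff_fst)).differentiable one_ne_zero
      (t₀, (0 : ℝ))).hasFDerivAt
  refine hc.contDiffAt.hasStrictFDerivAt' ((hd1.add (hasFDerivAt_snd.smul hd2)).congr_fderiv ?_)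
    one_ne_zero
  ext <;> simp [Units.smul_def, equivRealProdCLM_symm_apply, mul_comm]

/-- A periodic orbit is locally the zero section of its normal coordinates. -/
lemma exists_normalMap_box (hΩ : IsOpen Ω) (hX : ContDiffOn ℝ 1 X Ω)
    (hγ : ∀ t, HasDerivAt γ (X (γ t)) t) (hγΩ : ∀ t, γ t ∈ Ω) (hne : ∃ t₁ t₂, γ t₁ ≠ γ t₂)
    {T : ℝ} (hT : 0 < T) (hper : Function.Periodic γ T) (t₀ : ℝ) :
    ∃ r > 0, normalMap X γ '' (Metric.ball t₀ r ×ˢ Metric.ball 0 r) ∈ 𝓝 (γ t₀) ∧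
      ∀ t ∈ Metric.ball t₀ r, ∀ s ∈ Metric.ball (0 : ℝ) r, s ≠ 0 →
        normalMap X γ (t, s) ∉ range γ := by
  obtain ⟨L, hL⟩ := normalMap_hasStrictFDerivAt hΩ hX hγ hγΩ t₀
    (integralCurve_ne_zero hΩ hX hγ hγΩ hne t₀)
  have hzero : ∀ t, normalMap X γ (t, 0) = γ t := fun t => by simp [normalMap]
  have hmap := hL.map_nhds_eq_of_equiv
  rw [hzero] at hmap
  have hinj := hL.eventually_left_inverse
  obtain ⟨R, hR, hRinj⟩ := Metric.eventually_nhds_iff_ball.mp hinj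
  have hev : ∀ᶠ p in 𝓝 (t₀, (0 : ℝ)), normalMap X γ p ∈ range γ →
      ∃ t, |t - t₀| < R ∧ γ t = normalMap X γ p := by
    have := eventually_mem_range_imp hΩ hX hγ hγΩ hT hper t₀ hR
    rwa [← hmap, eventually_map] at this
  obtain ⟨S, hS, hSev⟩ := Metric.eventually_nhds_iff_ball.mp hev
  have hmin : 0 < min R S := lt_min hR hS
  refine ⟨min R S, hmin, ?_, fun t ht s hs hs0 hmem => ?_⟩
  · rw [← hmap]
    refine image_mem_map ?_
    rw [ball_prod_same]
    exact Metric.ball_mem_nhds _ hmin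
  · have hp : (t, s) ∈ Metric.ball (t₀, (0 : ℝ)) (min R S) := by
      rw [← ball_prod_same]; exact ⟨ht, hs⟩
    obtain ⟨u, hu, hut⟩ := hSev _ (Metric.ball_subset_ball (min_le_right _ _) hp) hmem
    have hu' : (u, (0 : ℝ)) ∈ Metric.ball (t₀, (0 : ℝ)) R := by
      rw [← ball_prod_same]; exact ⟨by rwa [Metric.mem_ball, Real.dist_eq], Metric.mem_ball_self hR⟩
    have e1 := hRinj _ (Metric.ball_subset_ball (min_le_left _ _) hp)
    have e2 := hRinj _ hu'
    rw [hzero, hut, e1] at e2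
    exact hs0 (congrArg Prod.snd e2)

/-- The winding number is constant on each side of a periodic orbit near each of its points. -/
lemma exists_cauchyLoop_sides (hΩ : IsOpen Ω) (hX : ContDiffOn ℝ 1 X Ω)
    (hγ : ∀ t, HasDerivAt γ (X (γ t)) t) (hγΩ : ∀ t, γ t ∈ Ω) (hne : ∃ t₁ t₂, γ t₁ ≠ γ t₂)
    {T : ℝ} (hT : 0 < T) (hper : Function.Periodic γ T) (t₀ : ℝ) :
    ∃ (r : ℝ) (A B : ℂ), 0 < r ∧
      (∀ t ∈ Metric.ball t₀ r, ∀ s ∈ Ioo 0 r, cauchyLoop γ T (normalMap X γ (t, s)) = A ∧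
        cauchyLoop γ T (normalMap X γ (t, -s)) = B) ∧
      ∀ᶠ z in 𝓝 (γ t₀), z ∉ range γ → cauchyLoop γ T z = A ∨ cauchyLoop γ T z = B := by
  obtain ⟨h1, h2⟩ := integralCurve_contDiff hΩ hX hγ hγΩ
  have hloop : γ T = γ 0 := by simpa using hper 0
  have hcl : IsClosed (range γ) := (hper.compact_of_continuous hT.ne' h1.continuous).isClosed
  have hc : Continuous (normalMap X γ) :=
    (h1.continuous.comp continuous_fst).add
      (continuous_snd.smul (continuous_const.mul (h2.continuous.comp continuous_fst)))
  obtain ⟨r, hr, hnhds, hoff⟩ := exists_normalMap_box hΩ hX hγ hγΩ hne hT hper t₀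
  have hside : ∀ J : Set ℝ, IsPreconnected J → J ⊆ Metric.ball 0 r → 0 ∉ J → ∀ s₀ ∈ J,
      ∀ t ∈ Metric.ball t₀ r, ∀ s ∈ J, cauchyLoop γ T (normalMap X γ (t, s)) =
        cauchyLoop γ T (normalMap X γ (t₀, s₀)) := by
    intro J hJ hJr hJ0 s₀ hs₀ t ht s hs
    refine cauchyLoop_eq_of_isPreconnected h1 hloop hcl
      (S := normalMap X γ '' (Metric.ball t₀ r ×ˢ J)) ?_ ?_ ⟨(t, s), ⟨ht, hs⟩, rfl⟩
      ⟨(t₀, s₀), ⟨Metric.mem_ball_self hr, hs₀⟩, rfl⟩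
    · exact ((convex_ball t₀ r).isPreconnected.prod hJ).image _ hc.continuousOn
    · rintro _ ⟨⟨t, s⟩, ⟨ht, hs⟩, rfl⟩
      exact hoff t ht s (hJr hs) fun h => hJ0 (h ▸ hs)
  have hpos := hside (Ioo 0 r) isPreconnected_Ioo
    (by rw [Real.ball_eq_Ioo]; exact Ioo_subset_Ioo (by linarith) (by linarith)) (by simp)
    (r / 2) ⟨by linarith, by linarith⟩
  have hneg := hside (Ioo (-r) 0) isPreconnected_Ioo
    (by rw [Real.ball_eq_Ioo]; exact Ioo_subset_Ioo (by linarith) (by linarith)) (by simp)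
    (-(r / 2)) ⟨by linarith, by linarith⟩
  refine ⟨r, _, _, hr, fun t ht s hs =>
    ⟨hpos t ht s hs, hneg t ht (-s) ⟨by linarith [hs.2], by linarith [hs.1]⟩⟩, ?_⟩
  filter_upwards [hnhds]
  rintro _ ⟨⟨t, s⟩, ⟨ht, hs⟩, rfl⟩ hz
  rw [Real.ball_eq_Ioo] at hs
  rcases lt_trichotomy s 0 with h | h | h
  · exact Or.inr (hneg t ht s ⟨by linarith [hs.1], h⟩)
  · exact absurd ⟨t, by simp [normalMap, h]⟩ hz
  · exact Or.inl (hpos t ht s ⟨h, by linarith [hs.2]⟩)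

/-- The winding number of a periodic orbit takes at most one nonzero value. -/
theorem exists_cauchyLoop_eq_zero_or (hΩ : IsOpen Ω) (hX : ContDiffOn ℝ 1 X Ω)
    (hγ : ∀ t, HasDerivAt γ (X (γ t)) t) (hγΩ : ∀ t, γ t ∈ Ω) (hne : ∃ t₁ t₂, γ t₁ ≠ γ t₂)
    {T : ℝ} (hT : 0 < T) (hper : Function.Periodic γ T) :
    ∃ A : ℂ, ∀ z ∉ range γ, cauchyLoop γ T z = 0 ∨ cauchyLoop γ T z = A := by
  obtain ⟨h1, -⟩ := integralCurve_contDiff hΩ hX hγ hγΩ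
  have hloop : γ T = γ 0 := by simpa using hper 0
  have hcomp : IsCompact (range γ) := hper.compact_of_continuous hT.ne' h1.continuous
  have hcl := hcomp.isClosed
  choose r A B hr hAB hnear using exists_cauchyLoop_sides hΩ hX hγ hγΩ hne hT hper
  have hloc : ∀ t u, t ∈ Metric.ball u (r u) → A t = A u ∧ B t = B u := by
    intro t u ht
    have hm : 0 < min (r t) (r u) := lt_min (hr t) (hr u)
    have hst : min (r t) (r u) / 2 ∈ Ioo 0 (r t) :=
      ⟨by linarith, by linarith [min_le_left (r t) (r u)]⟩
    have hsu : min (r t) (r u) / 2 ∈ Ioo 0 (r u) :=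
      ⟨by linarith, by linarith [min_le_right (r t) (r u)]⟩
    have e1 := hAB t t (Metric.mem_ball_self (hr t)) _ hst
    have e2 := hAB u t ht _ hsu
    exact ⟨e1.1.symm.trans e2.1, e1.2.symm.trans e2.2⟩
  have hconst : ∀ t, A t = A 0 ∧ B t = B 0 := by
    have hlc : IsLocallyConstant fun t => (A t, B t) :=
      (IsLocallyConstant.iff_eventually_eq _).mpr fun u => by
        filter_upwards [Metric.ball_mem_nhds u (hr u)] with t ht
        exact Prod.ext (hloc t u ht).1 (hloc t u ht).2
    intro t
    have := hlc.apply_eq_of_preconnectedSpace t 0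
    exact ⟨congrArg Prod.fst this, congrArg Prod.snd this⟩
  have htwo : ∀ z ∉ range γ, cauchyLoop γ T z = A 0 ∨ cauchyLoop γ T z = B 0 := by
    intro z hz
    by_contra hcon
    have hclopen : IsClopen {w | w ∉ range γ ∧ cauchyLoop γ T w = cauchyLoop γ T z} := by
      constructor
      · rw [← isOpen_compl_iff, isOpen_iff_eventually]
        intro w hw
        by_cases hwr : w ∈ range γ
        · obtain ⟨t, rfl⟩ := hwr
          filter_upwards [hnear t] with v hv
          rintro ⟨hv1, hv2⟩
          have := hv hv1
          rw [(hconst t).1, (hconst t).2, hv2] at this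
          exact hcon this
        · filter_upwards [eventually_cauchyLoop_eq h1 hloop hcl hwr] with v hv
          exact fun h => hw ⟨hwr, hv.2.symm.trans h.2⟩
      · rw [isOpen_iff_eventually]
        intro w hw
        filter_upwards [eventually_cauchyLoop_eq h1 hloop hcl hw.1] with v hv
        exact ⟨hv.1, hv.2.trans hw.2⟩
    have huniv := hclopen.eq_univ ⟨z, hz, rfl⟩
    exact (huniv.symm.subset (mem_univ (γ 0))).1 ⟨0, rfl⟩
  obtain ⟨R, hR⟩ := hcomp.isBounded.exists_norm_le
  obtain ⟨z, hz⟩ := NormedSpace.exists_lt_norm ℝ ℂ R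
  have hfar := cauchyLoop_eq_zero_of_bound_lt h1 hloop (fun t => hR _ ⟨t, rfl⟩) hz
  rcases htwo z hfar.1 with h | h <;> rw [hfar.2] at h
  · exact ⟨B 0, fun w hw => by rw [h]; exact htwo w hw⟩
  · exact ⟨A 0, fun w hw => by rw [h]; exact (htwo w hw).symm⟩

end

/-- If `γ` factors through a loop in a simply connected space whose image avoids `z`, then its
winding number around `z` vanishes. -/
lemma cauchyLoop_eq_zero_of_simplyConnected {Y : Type*} [TopologicalSpace Y]
    [SimplyConnectedSpace Y] [LocallyPathConnectedSpace Y] (f : C(Y, ℂ)) {σ : ℝ → Y}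
    (hσ : Continuous σ) {T : ℝ} (hT : σ T = σ 0) (hγ : ContDiff ℝ 1 (f ∘ σ)) {z : ℂ}
    (hz : ∀ y, f y ≠ z) : cauchyLoop (f ∘ σ) T z = 0 := by
  have hne : ∀ y, f y - z ≠ 0 := fun y => sub_ne_zero.mpr (hz y)
  obtain ⟨l, ⟨-, hl⟩, -⟩ := isCoveringMapOn_exp.existsUnique_continuousMap_lifts
    (⟨fun y => f y - z, by fun_prop⟩ : C(Y, ℂ)) (a₀ := σ 0) (e₀ := log (f (σ 0) - z))
    (exp_log (hne _)) hne
  rw [cauchyLoop_eq_sub_of_exp_eq hγ (by rintro ⟨t, ht⟩; exact hz _ ht) (l.continuous.comp hσ)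
    fun t => congrFun hl (σ t)]
  simp [hT]

/-- Dulac's criterion in complex notation: `g` plays the role of the conjugate of `B • X`. -/
theorem false_of_dbar_re_pos {Ω : Set ℂ} (hΩ : IsOpen Ω) {X g : ℂ → ℂ} (hX : ContDiffOn ℝ 1 X Ω)
    (hg : ContDiffOn ℝ 1 g Ω) {γ : ℝ → ℂ} (hγ : ∀ t, HasDerivAt γ (X (γ t)) t)
    (hγΩ : ∀ t, γ t ∈ Ω) (hne : ∃ t₁ t₂, γ t₁ ≠ γ t₂) {T : ℝ} (hT : 0 < T)
    (hper : Function.Periodic γ T) (hW : ∀ z ∉ Ω, cauchyLoop γ T z = 0)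
    (hdiv : ∀ z ∈ Ω, 0 < (dbar g z).re) (him : ∀ t, (g (γ t) * X (γ t)).im = 0) : False := by
  obtain ⟨h1, h2⟩ := integralCurve_contDiff hΩ hX hγ hγΩ
  have hloop : γ T = γ 0 := by simpa using hper 0
  have hcomp : IsCompact (range γ) := hper.compact_of_continuous hT.ne' h1.continuous
  have hrange : range γ ⊆ Ω := range_subset_iff.mpr hγΩ
  have hU := isOpen_cauchyLoop_ne_zero (T := T) h1 hcomp.isClosed
  have hK := isCompact_range_union_cauchyLoop_ne_zero h1 hloop hcomp
  have hgreen := fun {f : ℂ → ℂ} (hf : ContDiffOn ℝ 1 f Ω) =>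
    intervalIntegral_mul_deriv_eq_setIntegral hΩ hf h1 hT.le hloop hcomp hrange hW
  simp only [(hγ _).deriv] at hgreen
  set U := {z | z ∉ range γ ∧ cauchyLoop γ T z ≠ 0} with hUdef
  have hUΩ : U ⊆ Ω := fun z hz => by_contra fun h => hz.2 (hW z h)
  rcases U.eq_empty_or_nonempty with hempty | ⟨z, hz⟩
  · have hconj := hgreen (conjCLE.contDiff.comp_contDiffOn hX)
    rw [hempty, Measure.restrict_empty, integral_zero_measure] at hconj
    have hpos : 0 < ∫ t in (0 : ℝ)..T, normSq (X (γ t)) :=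
      intervalIntegral.intervalIntegral_pos_of_pos
        ((continuous_normSq.comp h2.continuous).intervalIntegrable _ _)
        (fun t => normSq_pos.mpr (integralCurve_ne_zero hΩ hX hγ hγΩ hne t)) hT
    have hint : ∫ t in (0 : ℝ)..T, (conjCLE ∘ X) (γ t) * X (γ t) =
        ((∫ t in (0 : ℝ)..T, normSq (X (γ t)) : ℝ) : ℂ) := by
      rw [← intervalIntegral.integral_ofReal]
      simp [normSq_eq_conj_mul_self]
    rw [hint] at hconj
    norm_cast at hconj
    have := mul_pos Real.two_pi_pos hpos
    linarith
  · obtain ⟨A, hA⟩ := exists_cauchyLoop_eq_zero_or hΩ hX hγ hγΩ hne hT hper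
    obtain ⟨k, hk⟩ := exists_cauchyLoop_eq_int_mul h1 hloop hz.1
    have hAU : ∀ w ∈ U, cauchyLoop γ T w = A := fun w hw => (hA w hw.1).resolve_left hw.2
    rw [hAU z hz] at hk
    have hk0 : (k : ℝ) ≠ 0 := by
      intro h
      have : k = 0 := by exact_mod_cast h
      exact hz.2 (by rw [hAU z hz, hk, this]; simp)
    have hcont : ContinuousOn (dbar g) Ω := by
      have := hg.continuousOn_fderiv_of_isOpen hΩ le_rfl
      unfold dbar
      fun_prop
    have hintg : IntegrableOn (dbar g) U :=
      ((hcont.mono (union_subset hrange hUΩ)).integrableOn_compact hK).mono_set subset_union_right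
    have hpos : 0 < ∫ w in U, (dbar g w).re := by
      rw [setIntegral_pos_iff_support_of_nonneg_ae
        (ae_restrict_of_forall_mem hU.measurableSet fun w hw => (hdiv w (hUΩ hw)).le) hintg.re]
      have : Function.support (fun w => (dbar g w).re) ∩ U = U :=
        inter_eq_right.mpr fun w hw => (hdiv w (hUΩ hw)).ne'
      rw [this]
      exact hU.measure_pos volume ⟨z, hz⟩
    have hline : (∫ t in (0 : ℝ)..T, g (γ t) * X (γ t)).im = 0 := by
      have hc : Continuous fun t => g (γ t) * X (γ t) :=
        (hg.continuousOn.comp_continuous h1.continuous hγΩ).mul h2.continuous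
      have := imCLM.intervalIntegral_comp_comm (hc.intervalIntegrable (μ := volume) 0 T)
      simpa [him] using this.symm
    have hmain := hgreen hg
    rw [setIntegral_congr_fun hU.measurableSet
      (fun w hw => by simp only [hAU w hw] : EqOn _ (fun w => dbar g w * A) U),
      integral_mul_const, hk] at hmain
    have hre : (∫ w in U, dbar g w).re = ∫ w in U, (dbar g w).re :=
      (reCLM.integral_comp_comm hintg).symm
    have := congrArg Complex.im hmain
    rw [← hre] at hpos
    simp [hline, hk0, hpos.ne', Real.pi_ne_zero] at this

/-- **Dulac criterion.** Let `Ω ⊆ ℝ²` be an open, simply connected region,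
`X = (P, Q)` a `C¹` vector field on `Ω`, and `B : Ω → ℝ` a `C¹` function with
`div (B • X) > 0` everywhere on `Ω`. Then the planar ODE `x' = P, y' = Q` has
no periodic (i.e. nonconstant, periodic) orbit entirely contained in `Ω`. -/
theorem dulac_criterion
    (Ω : Set (ℝ × ℝ)) (hΩopen : IsOpen Ω) (hΩsc : SimplyConnectedSpace Ω)
    (P Q B : ℝ × ℝ → ℝ)
    (hP : ContDiffOn ℝ 1 P Ω) (hQ : ContDiffOn ℝ 1 Q Ω)
    (hB : ContDiffOn ℝ 1 B Ω)
    (hdiv : ∀ z ∈ Ω,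
      0 < fderiv ℝ (fun w => B w * P w) z (1, 0) +
          fderiv ℝ (fun w => B w * Q w) z (0, 1)) :
    ¬ ∃ (γ : ℝ → ℝ × ℝ) (T : ℝ), 0 < T ∧
        (∀ t, HasDerivAt γ (P (γ t), Q (γ t)) t) ∧
        (∀ t, γ (t + T) = γ t) ∧
        (∃ t₁ t₂, γ t₁ ≠ γ t₂) ∧
        (∀ t, γ t ∈ Ω) := by
  rintro ⟨γ, T, hT, hγ, hper, ⟨t₁, t₂, hne⟩, hγΩ⟩
  set e : ℂ ≃L[ℝ] ℝ × ℝ := equivRealProdCLM with he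
  have hΩ' : IsOpen (e ⁻¹' Ω) := hΩopen.preimage e.continuous
  have hpull : ∀ {f : ℝ × ℝ → ℝ}, ContDiffOn ℝ 1 f Ω →
      ContDiffOn ℝ 1 (fun w => (f (e w) : ℂ)) (e ⁻¹' Ω) := fun hf =>
    ofRealCLM.contDiff.comp_contDiffOn (hf.comp e.contDiff.contDiffOn fun _ hw => hw)
  have hX : ContDiffOn ℝ 1 (fun w => (P (e w) : ℂ) + Q (e w) * I) (e ⁻¹' Ω) :=
    (hpull hP).add ((hpull hQ).mul contDiffOn_const)
  have hBP := hB.mul hP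
  have hBQ := hB.mul hQ
  have hg : ContDiffOn ℝ 1
      (fun w => ((B (e w) * P (e w) : ℝ) : ℂ) - ((B (e w) * Q (e w) : ℝ) : ℂ) * I) (e ⁻¹' Ω) :=
    (hpull hBP).sub ((hpull hBQ).mul contDiffOn_const)
  have hγ' : ∀ t, HasDerivAt (fun t => e.symm (γ t))
      ((P (e (e.symm (γ t))) : ℂ) + Q (e (e.symm (γ t))) * I) t := by
    intro t
    refine (e.symm.hasFDerivAt.comp_hasDerivAt t (hγ t)).congr_deriv ?_
    simp [he, equivRealProdCLM_symm_apply]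
  have hγ'Ω : ∀ t, e.symm (γ t) ∈ e ⁻¹' Ω := fun t => by simpa using hγΩ t
  have hγc : Continuous γ := continuous_iff_continuousAt.mpr fun t => (hγ t).continuousAt
  refine false_of_dbar_re_pos hΩ' hX hg hγ' hγ'Ω ⟨t₁, t₂, fun h => hne (e.symm.injective h)⟩ hT
    (fun t => by simp [hper t]) (fun z hz => ?_) (fun z hz => ?_) fun t => ?_
  · have := hΩopen.locallyPathConnectedSpace
    refine cauchyLoop_eq_zero_of_simplyConnected (Y := Ω)
      ⟨fun y => e.symm y, e.symm.continuous.comp continuous_subtype_val⟩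
      (σ := fun t => ⟨γ t, hγΩ t⟩) (hγc.subtype_mk _) (Subtype.ext (by simpa using hper 0))
      (integralCurve_contDiff hΩ' hX hγ' hγ'Ω).1 fun y hy => hz ?_
    rw [← hy]
    simp
  · have hfd : ∀ {f : ℝ × ℝ → ℝ}, ContDiffOn ℝ 1 f Ω → HasFDerivAt (fun w => (f (e w) : ℂ))
        (ofRealCLM ∘L (fderiv ℝ f (e z)) ∘L (e : ℂ →L[ℝ] ℝ × ℝ)) z := fun hf =>
      ofRealCLM.hasFDerivAt.comp z ((((hf.contDiffAt (hΩopen.mem_nhds hz)).differentiableAt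
        one_ne_zero).hasFDerivAt).comp z e.hasFDerivAt)
    have h : HasFDerivAt (fun w =>
        ((B (e w) * P (e w) : ℝ) : ℂ) - ((B (e w) * Q (e w) : ℝ) : ℂ) * I) _ z :=
      (hfd hBP).sub ((hfd hBQ).mul_const I)
    rw [dbar, h.fderiv]
    refine lt_of_lt_of_eq (hdiv (e z) hz) ?_
    simp [he]
  · simp
    ring
end

section
/- Let Ω ⊆ ℝ² be an open, simply connected region, X = (P,Q) : Ω → ℝ² a C¹ vector field, B : Ω → ℝ a C¹ function, and g : Ω → ℝ a continuous function such that div(B·X) = g on Ω and g(z) > 0 for all z ∈ Ω outside a set of Lebesgue measure zero. Then the planar differential equation x' = P(x,y), y' = Q(x,y) possesses no periodic orbit that is entirely contained in Ω. -/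
open MeasureTheory

theorem exists_contDiff_hasCompactSupport_eqOn {E : Type*} [NormedAddCommGroup E]
    [NormedSpace ℝ E] [FiniteDimensional ℝ E] {U K : Set E} {f : E → ℝ}
    (hU : IsOpen U) (hK : IsCompact K) (hKU : K ⊆ U) (hf : ContDiffOn ℝ 1 f U) :
    ∃ F : E → ℝ, ContDiff ℝ 1 F ∧ HasCompactSupport F ∧ Set.EqOn F f K := by
  obtain ⟨L, hL, hKL, hLU⟩ := exists_compact_between hK hU hKU
  obtain ⟨ρ, hρ, -, hρL, hρK⟩ := exists_contMDiff_support_eq_eq_one_iff (n := 1)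
    (modelWithCornersSelf ℝ E) (isOpen_interior (s := L)) hK.isClosed hKL
  have hρ' : ContDiff ℝ 1 ρ := hρ.contDiff
  have hzero : ∀ x ∉ L, ρ x * f x = 0 := fun x hx => by
    have : ρ x = 0 := by
      by_contra h
      have : x ∈ interior L := hρL ▸ h
      exact hx (interior_subset this)
    simp [this]
  refine ⟨fun x => ρ x * f x, ?_, HasCompactSupport.intro hL hzero, fun x hx => ?_⟩
  · rw [contDiff_iff_contDiffAt]
    intro x
    by_cases hx : x ∈ U
    · exact hρ'.contDiffAt.mul (hf.contDiffAt (hU.mem_nhds hx))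
    · refine (contDiffAt_const (c := (0 : ℝ))).congr_of_eventuallyEq ?_
      filter_upwards [hL.isClosed.isOpen_compl.mem_nhds fun h => hx (hLU h)] with y hy
      exact hzero y hy
  · simp [(hρK x).1 hx]

theorem intervalIntegral_div_eq_zero_of_exp_eq {u u' f : ℝ → ℂ} {a b : ℝ}
    (hu : ∀ t, HasDerivAt u (u' t) t) (hu' : Continuous u') (hf : Continuous f)
    (hexp : ∀ t, Complex.exp (f t) = u t) (hab : f a = f b) :
    ∫ t in a..b, u' t / u t = 0 := by
  have hu0 : ∀ t, u t ≠ 0 := fun t => hexp t ▸ Complex.exp_ne_zero _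
  have huc : Continuous u := continuous_iff_continuousAt.2 fun t => (hu t).continuousAt
  have hderiv : ∀ t, HasDerivAt f (u' t / u t) t := by
    intro t
    have h1 : HasDerivAt (fun s => f t + Complex.log (u s / u t)) (u' t / u t) t := by
      have h2 : HasDerivAt (fun s => u s / u t) (u' t / u t) t := (hu t).div_const _
      have h3 := (h2.clog_real (by simp [hu0 t])).const_add (f t)
      simpa [hu0 t] using h3
    refine h1.congr_of_eventuallyEq ?_
    have h4 : ∀ᶠ s in nhds t, ‖f s - f t‖ < Real.pi := by
      have : Filter.Tendsto (fun s => ‖f s - f t‖) (nhds t) (nhds 0) := by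
        have := (hf.sub (continuous_const (y := f t))).norm.tendsto t
        simpa using this
      exact this.eventually (gt_mem_nhds Real.pi_pos)
    filter_upwards [h4] with s hs
    have him := (Complex.abs_im_le_norm _).trans_lt hs
    rw [abs_lt] at him
    rw [← hexp s, ← hexp t, ← Complex.exp_sub, Complex.log_exp him.1 him.2.le]
    ring
  rw [intervalIntegral.integral_eq_sub_of_hasDerivAt (fun t _ => hderiv t)
    ((hu'.div huc hu0).intervalIntegrable _ _), hab, sub_self]

theorem intervalIntegral_div_eq_zero_of_norm_sub_one_lt {u u' : ℝ → ℂ} {a b : ℝ}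
    (hu : ∀ t, HasDerivAt u (u' t) t) (hu' : Continuous u') (hone : ∀ t, ‖u t - 1‖ < 1)
    (hab : u a = u b) :
    ∫ t in a..b, u' t / u t = 0 := by
  have huc : Continuous u := continuous_iff_continuousAt.2 fun t => (hu t).continuousAt
  have hslit : ∀ t, u t ∈ Complex.slitPlane := fun t => by
    simpa using Complex.mem_slitPlane_of_norm_lt_one (hone t)
  refine intervalIntegral_div_eq_zero_of_exp_eq (f := fun t => Complex.log (u t)) hu hu'
    (huc.clog hslit)
    (fun t => Complex.exp_log (Complex.slitPlane_ne_zero (hslit t))) (by simp [hab])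

theorem half_le_re_div {a b : ℂ} (ha : ‖a - 1‖ ≤ 1 / 16) (hb : ‖b - 1‖ ≤ 3 / 16) :
    1 / 2 ≤ (a / b).re := by
  have hb1 : 13 / 16 ≤ ‖b‖ := by
    have := norm_sub_norm_le (1 : ℂ) b
    rw [norm_sub_rev, norm_one] at this
    linarith
  have hb0 : b ≠ 0 := by
    rintro rfl
    simp at hb1
    linarith
  have hab : ‖a - b‖ ≤ 1 / 4 := by
    calc ‖a - b‖ = ‖(a - 1) - (b - 1)‖ := by ring_nf
      _ ≤ ‖a - 1‖ + ‖b - 1‖ := norm_sub_le _ _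
      _ ≤ _ := by linarith
  have hq : ‖(a - b) / b‖ ≤ 1 / 2 := by
    rw [norm_div, div_le_iff₀ (by linarith)]
    linarith
  have he : a / b = 1 + (a - b) / b := by field_simp; ring
  have := (abs_le.1 ((Complex.abs_re_le_norm _).trans hq)).1
  rw [he, Complex.add_re, Complex.one_re]
  linarith

/-- Crossing a regular curve at a simple point changes the logarithmic integral. -/
theorem exists_jump_of_deriv_eq_one {u u' : ℝ → ℂ} {S : ℝ} (hS : 0 < S)
    (hu : ∀ t, HasDerivAt u (u' t) t) (hu' : Continuous u') (hu0 : u 0 = 0) (hu1 : u' 0 = 1)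
    (hsimple : ∀ t ∈ Set.Icc (-S) S, t ≠ 0 → u t ≠ 0) :
    ∃ ε : ℝ, (∀ t ∈ Set.Icc (-S) S, u t - ε * Complex.I ≠ 0 ∧ u t + ε * Complex.I ≠ 0) ∧
      ∫ t in (-S)..S, u' t / (u t - ε * Complex.I) ≠
        ∫ t in (-S)..S, u' t / (u t + ε * Complex.I) := by
  have huc : Continuous u := continuous_iff_continuousAt.2 fun t => (hu t).continuousAt
  obtain ⟨δ, hδ, hnear⟩ : ∃ δ > 0, ∀ t : ℝ, |t| < δ →
      ‖u' t - 1‖ ≤ 1 / 16 ∧ ‖u t - t‖ ≤ 1 / 16 * |t| := by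
    have h1 : ∀ᶠ t in nhds (0 : ℝ), ‖u' t - 1‖ < 1 / 16 := by
      have : Filter.Tendsto (fun t => ‖u' t - 1‖) (nhds 0) (nhds 0) := by
        have := (hu'.sub (continuous_const (y := (1 : ℂ)))).norm.tendsto 0
        simpa [hu1] using this
      exact this.eventually (gt_mem_nhds (by norm_num))
    have h2 := (hasDerivAt_iff_isLittleO.1 (hu 0)).def (c := 1 / 16) (by norm_num)
    obtain ⟨δ, hδ, h⟩ := Metric.eventually_nhds_iff.1 (h1.and h2)
    refine ⟨δ, hδ, fun t ht => ?_⟩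
    have := h (y := t) (by simpa using ht)
    exact ⟨this.1.le, by simpa [hu0, hu1] using this.2⟩
  obtain ⟨m, hm, hfar⟩ : ∃ m > 0, ∀ t ∈ Set.Icc (-S) S, δ ≤ |t| → m ≤ ‖u t‖ := by
    have hc : IsCompact (Set.Icc (-S) S ∩ {t | δ ≤ |t|}) :=
      isCompact_Icc.inter_right (isClosed_le continuous_const continuous_abs)
    rcases Set.eq_empty_or_nonempty (Set.Icc (-S) S ∩ {t | δ ≤ |t|}) with h | h
    · exact ⟨1, one_pos, fun t h1 h2 => (h.subset ⟨h1, h2⟩).elim⟩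
    · obtain ⟨t₀, ht₀, hmin⟩ := hc.exists_isMinOn h huc.norm.continuousOn
      refine ⟨‖u t₀‖, norm_pos_iff.2 (hsimple t₀ ht₀.1 ?_), fun t h1 h2 => hmin ⟨h1, h2⟩⟩
      rintro rfl
      have := ht₀.2
      simp at this
      linarith
  obtain ⟨C, hC⟩ := isCompact_Icc.exists_bound_of_continuousOn
    (hu'.continuousOn (s := Set.Icc (-S) S))
  have hC0 : 0 ≤ C := (norm_nonneg _).trans (hC 0 ⟨by linarith, by linarith⟩)
  set K : ℝ := 4 * C / m ^ 2 + 1 / δ ^ 2 with hK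
  have hK0 : 0 < K := by positivity
  obtain ⟨ε, hε, hεS, hεm, hεK⟩ : ∃ ε > 0, ε ≤ S ∧ ε ≤ m / 2 ∧ 2 * S * K * ε ≤ 1 := by
    refine ⟨min S (min (m / 2) (1 / (2 * S * K))), by positivity, min_le_left _ _,
      (min_le_right _ _).trans (min_le_left _ _), ?_⟩
    calc 2 * S * K * _ ≤ 2 * S * K * (1 / (2 * S * K)) := by
          gcongr
          exact (min_le_right _ _).trans (min_le_right _ _)
      _ = 1 := by field_simp
  have key : ∀ t ∈ Set.Icc (-S) S, u t ^ 2 + (ε : ℂ) ^ 2 ≠ 0 ∧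
      ε / (t ^ 2 + ε ^ 2) - K * ε ≤ (2 * ε * u' t / (u t ^ 2 + (ε : ℂ) ^ 2)).re := by
    intro t ht
    rcases lt_or_ge |t| δ with h | h
    · obtain ⟨h1, h2⟩ := hnear t h
      have hM : 0 < t ^ 2 + ε ^ 2 := by positivity
      have hMc : ((t ^ 2 + ε ^ 2 : ℝ) : ℂ) ≠ 0 := by exact_mod_cast hM.ne'
      have hb : ‖(u t ^ 2 + (ε : ℂ) ^ 2) / ((t ^ 2 + ε ^ 2 : ℝ) : ℂ) - 1‖ ≤ 3 / 16 := by
        have e : (u t ^ 2 + (ε : ℂ) ^ 2) / ((t ^ 2 + ε ^ 2 : ℝ) : ℂ) - 1 =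
            (u t - t) * ((u t - t) + 2 * t) / ((t ^ 2 + ε ^ 2 : ℝ) : ℂ) := by
          rw [div_sub_one hMc]
          push_cast
          ring
        rw [e, norm_div, Complex.norm_real, Real.norm_of_nonneg hM.le, div_le_iff₀ hM, norm_mul]
        have h3 : ‖u t - t + 2 * t‖ ≤ 3 * |t| := by
          refine (norm_add_le _ _).trans ?_
          simp only [norm_mul, Complex.norm_real, Real.norm_eq_abs, Complex.norm_ofNat]
          linarith [abs_nonneg t]
        calc ‖u t - t‖ * ‖u t - t + 2 * t‖ ≤ (1 / 16 * |t|) * (3 * |t|) := by gcongr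
          _ = 3 / 16 * t ^ 2 := by rw [← sq_abs t]; ring
          _ ≤ _ := by nlinarith [sq_nonneg ε]
      have hre := half_le_re_div h1 hb
      refine ⟨fun h0 => ?_, ?_⟩
      · rw [h0] at hb
        norm_num at hb
      · have e : 2 * ε * u' t / (u t ^ 2 + (ε : ℂ) ^ 2) = ((2 * ε / (t ^ 2 + ε ^ 2) : ℝ) : ℂ) *
            (u' t / ((u t ^ 2 + (ε : ℂ) ^ 2) / ((t ^ 2 + ε ^ 2 : ℝ) : ℂ))) := by
          rw [Complex.ofReal_div]
          field_simp
          push_cast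
          ring
        rw [e, Complex.re_ofReal_mul]
        have : 2 * ε / (t ^ 2 + ε ^ 2) * (1 / 2) ≤ 2 * ε / (t ^ 2 + ε ^ 2) *
            (u' t / ((u t ^ 2 + (ε : ℂ) ^ 2) / ((t ^ 2 + ε ^ 2 : ℝ) : ℂ))).re := by gcongr
        have e2 : 2 * ε / (t ^ 2 + ε ^ 2) * (1 / 2) = ε / (t ^ 2 + ε ^ 2) := by ring
        have : 0 < K * ε := by positivity
        linarith
    · have hmu := hfar t ht h
      have hD : m ^ 2 / 2 ≤ ‖u t ^ 2 + (ε : ℂ) ^ 2‖ := by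
        have h1 := norm_sub_norm_le (u t ^ 2) (-(ε : ℂ) ^ 2)
        rw [sub_neg_eq_add, norm_neg, norm_pow, norm_pow, Complex.norm_real,
          Real.norm_of_nonneg hε.le] at h1
        nlinarith
      have hD0 : 0 < ‖u t ^ 2 + (ε : ℂ) ^ 2‖ := lt_of_lt_of_le (by positivity) hD
      refine ⟨norm_pos_iff.1 hD0, ?_⟩
      have h1 : ‖2 * ε * u' t / (u t ^ 2 + (ε : ℂ) ^ 2)‖ ≤ 4 * C / m ^ 2 * ε := by
        rw [norm_div, norm_mul, norm_mul, Complex.norm_real, Real.norm_of_nonneg hε.le,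
          Complex.norm_ofNat]
        calc 2 * ε * ‖u' t‖ / ‖u t ^ 2 + (ε : ℂ) ^ 2‖ ≤ 2 * ε * C / (m ^ 2 / 2) := by
              gcongr
              exact hC t ht
          _ = _ := by field_simp; ring
      have h2 := (abs_le.1 ((Complex.abs_re_le_norm _).trans h1)).1
      have h3 : ε / (t ^ 2 + ε ^ 2) ≤ 1 / δ ^ 2 * ε := by
        rw [div_mul_eq_mul_div, one_mul]
        have : δ ^ 2 ≤ t ^ 2 := by rw [← sq_abs t]; gcongr
        gcongr
        nlinarith [sq_nonneg ε]
      rw [hK]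
      linarith
  have hfac : ∀ t, u t ^ 2 + (ε : ℂ) ^ 2 = (u t - ε * Complex.I) * (u t + ε * Complex.I) := by
    intro t
    linear_combination (ε : ℂ) ^ 2 * Complex.I_sq
  have hne : ∀ t ∈ Set.Icc (-S) S, u t - ε * Complex.I ≠ 0 ∧ u t + ε * Complex.I ≠ 0 := by
    intro t ht
    have := (key t ht).1
    rw [hfac] at this
    exact ⟨left_ne_zero_of_mul this, right_ne_zero_of_mul this⟩
  refine ⟨ε, hne, fun heq => ?_⟩
  have hSS : -S ≤ S := by linarith
  have hI : ∀ s : ℂ, (∀ t ∈ Set.Icc (-S) S, u t + s ≠ 0) →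
      IntervalIntegrable (fun t => u' t / (u t + s)) volume (-S) S := fun s hs => by
    refine ContinuousOn.intervalIntegrable ?_
    rw [Set.uIcc_of_le hSS]
    exact hu'.continuousOn.div (huc.add continuous_const).continuousOn hs
  have hI1 := hI (-(ε * Complex.I)) (fun t ht => by simpa [sub_eq_add_neg] using (hne t ht).1)
  simp only [← sub_eq_add_neg] at hI1
  have hI2 := hI (ε * Complex.I) (fun t ht => (hne t ht).2)
  have hcont3 : ContinuousOn (fun t => 2 * ε * u' t / (u t ^ 2 + (ε : ℂ) ^ 2))
      (Set.uIcc (-S) S) := by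
    rw [Set.uIcc_of_le hSS]
    exact (continuous_const.mul hu').continuousOn.div
      ((huc.pow 2).add continuous_const).continuousOn fun t ht => (key t ht).1
  have hI3 : IntervalIntegrable (fun t => 2 * ε * u' t / (u t ^ 2 + (ε : ℂ) ^ 2))
      volume (-S) S := hcont3.intervalIntegrable
  have hzero : ∫ t in (-S)..S, 2 * ε * u' t / (u t ^ 2 + (ε : ℂ) ^ 2) = 0 := by
    have h1 := sub_eq_zero.2 heq
    rw [← intervalIntegral.integral_sub hI1 hI2] at h1
    have h2 : ∫ t in (-S)..S, (-Complex.I) * (u' t / (u t - ε * Complex.I) -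
        u' t / (u t + ε * Complex.I)) = 0 := by
      rw [intervalIntegral.integral_const_mul, h1, mul_zero]
    rw [← h2]
    refine intervalIntegral.integral_congr fun t ht => ?_
    rw [Set.uIcc_of_le hSS] at ht
    have h3 := (hne t ht).1
    have h4 := (hne t ht).2
    simp only [hfac]
    rw [div_sub_div _ _ h3 h4, ← mul_div_assoc]
    congr 1
    linear_combination (2 * ε * u' t) * Complex.I_sq
  have hre : ∫ t in (-S)..S, (2 * ε * u' t / (u t ^ 2 + (ε : ℂ) ^ 2)).re = 0 := by
    have := Complex.reCLM.intervalIntegral_comp_comm hI3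
    rwa [hzero, map_zero] at this
  have harc : ∀ t : ℝ, HasDerivAt (fun t => Real.arctan (t / ε) - K * ε * t)
      (ε / (t ^ 2 + ε ^ 2) - K * ε) t := by
    intro t
    have h1 := ((hasDerivAt_id t).div_const ε).arctan.sub ((hasDerivAt_id t).const_mul (K * ε))
    refine h1.congr_deriv ?_
    simp only [id]
    field_simp
    ring
  have hcont : Continuous fun t : ℝ => ε / (t ^ 2 + ε ^ 2) - K * ε := by
    refine (continuous_const.div (by fun_prop) fun t => ?_).sub continuous_const
    positivity
  have hlow : ∫ t in (-S)..S, (ε / (t ^ 2 + ε ^ 2) - K * ε) ≤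
      ∫ t in (-S)..S, (2 * ε * u' t / (u t ^ 2 + (ε : ℂ) ^ 2)).re :=
    intervalIntegral.integral_mono_on hSS (hcont.intervalIntegrable _ _)
      (Complex.continuous_re.comp_continuousOn hcont3).intervalIntegrable fun t ht => (key t ht).2
  rw [intervalIntegral.integral_eq_sub_of_hasDerivAt (fun t _ => harc t)
    (hcont.intervalIntegrable _ _)] at hlow
  have hpi : Real.pi / 4 ≤ Real.arctan (S / ε) := by
    rw [← Real.arctan_one]
    exact Real.arctan_le_arctan_iff.2 ((one_le_div hε).2 hεS)
  rw [neg_div, Real.arctan_neg] at hlow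
  have := Real.pi_gt_three
  rw [hre] at hlow
  linarith

/-- A closed `C¹` curve with a regular simple point winds around the points of a nonempty bounded
open set whose frontier lies on the curve. -/
theorem exists_isOpen_logIntegral_ne_zero {c c' : ℝ → ℂ} {S : ℝ} (hS : 0 < S)
    (hc : ∀ t, HasDerivAt c (c' t) t) (hc' : Continuous c') (hc0 : c' 0 ≠ 0)
    (hper : Function.Periodic c (2 * S))
    (hsimple : ∀ t ∈ Set.Icc (-S) S, t ≠ 0 → c t ≠ c 0) :
    ∃ D : Set ℂ, IsOpen D ∧ D.Nonempty ∧ Bornology.IsBounded D ∧ frontier D ⊆ Set.range c ∧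
      Set.range c ⊆ Dᶜ ∧ ∀ z ∈ D, ∫ t in (-S)..S, c' t / (c t - z) ≠ 0 := by
  have hcc : Continuous c := continuous_iff_continuousAt.2 fun t => (hc t).continuousAt
  have hend : c (-S) = c S := by
    rw [← hper (-S)]
    ring_nf
  have hrange : Set.range c = c '' Set.Icc (-S) S := by
    rw [← hper.image_Icc (by linarith : 0 < 2 * S) (-S)]
    congr 2
    ring
  have hcomp : IsCompact (Set.range c) := hrange ▸ isCompact_Icc.image hcc
  have hmem : ∀ z, z ∉ Set.range c → ∀ t, c t - z ≠ 0 := fun z hz t h =>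
    hz ⟨t, sub_eq_zero.1 h⟩
  have hInt : ∀ z, z ∉ Set.range c →
      IntervalIntegrable (fun t => c' t / (c t - z)) volume (-S) S := fun z hz =>
    (hc'.div (hcc.sub continuous_const) (hmem z hz)).intervalIntegrable _ _
  have hlocal : ∀ z, z ∉ Set.range c → ∃ r > 0, ∀ y ∈ Metric.ball z r, y ∉ Set.range c ∧
      ∫ t in (-S)..S, c' t / (c t - y) = ∫ t in (-S)..S, c' t / (c t - z) := by
    intro z hz
    obtain ⟨r, hr, hball⟩ := Metric.isOpen_iff.1 hcomp.isClosed.isOpen_compl z hz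
    refine ⟨r, hr, fun y hy => ⟨hball hy, ?_⟩⟩
    have hy' := hmem y (hball hy)
    have hz' := hmem z hz
    have hu : ∀ t, HasDerivAt (fun s => (c s - y) / (c s - z))
        ((c' t * (c t - z) - (c t - y) * c' t) / (c t - z) ^ 2) t := fun t =>
      ((hc t).sub_const y).div ((hc t).sub_const z) (hz' t)
    have h0 := intervalIntegral_div_eq_zero_of_norm_sub_one_lt (a := -S) (b := S) hu
      (((hc'.mul (hcc.sub continuous_const)).sub ((hcc.sub continuous_const).mul hc')).div
        ((hcc.sub continuous_const).pow 2) fun t => pow_ne_zero 2 (hz' t))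
      (fun t => by
        have hlt : ‖z - y‖ < ‖c t - z‖ := by
          have h1 : r ≤ ‖c t - z‖ := by
            by_contra! h
            exact hball (mem_ball_iff_norm.2 h) ⟨t, rfl⟩
          rw [norm_sub_rev]
          exact (mem_ball_iff_norm.1 hy).trans_le h1
        rw [div_sub_one (hz' t), norm_div, div_lt_one (norm_pos_iff.2 (hz' t))]
        simpa using hlt) (by simp only [hend])
    rw [← sub_eq_zero, ← intervalIntegral.integral_sub (hInt y (hball hy)) (hInt z hz), ← h0]
    refine intervalIntegral.integral_congr fun t _ => ?_
    have h1 := hy' t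
    have h2 := hz' t
    field_simp
  obtain ⟨R, hR⟩ := hcomp.isBounded.exists_norm_le
  refine ⟨{z | z ∉ Set.range c ∧ ∫ t in (-S)..S, c' t / (c t - z) ≠ 0}, ?_, ?_, ?_, ?_, ?_,
    fun z hz => hz.2⟩
  · rw [Metric.isOpen_iff]
    rintro z ⟨hz, hne⟩
    obtain ⟨r, hr, h⟩ := hlocal z hz
    exact ⟨r, hr, fun y hy => ⟨(h y hy).1, (h y hy).2 ▸ hne⟩⟩
  · obtain ⟨ε, hε, hjump⟩ := exists_jump_of_deriv_eq_one (u := fun t => (c t - c 0) / c' 0)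
      (u' := fun t => c' t / c' 0) hS (fun t => ((hc t).sub_const _).div_const _)
      (hc'.div_const _) (by simp) (div_self hc0)
      (fun t ht h => div_ne_zero (sub_ne_zero.2 (hsimple t ht h)) hc0)
    have hval : ∀ s : ℂ, (∀ t ∈ Set.Icc (-S) S, (c t - c 0) / c' 0 + s ≠ 0) →
        c 0 - c' 0 * s ∉ Set.range c ∧ ∫ t in (-S)..S, c' t / (c t - (c 0 - c' 0 * s)) =
          ∫ t in (-S)..S, c' t / c' 0 / ((c t - c 0) / c' 0 + s) := by
      intro s hs
      refine ⟨?_, intervalIntegral.integral_congr fun t _ => ?_⟩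
      · rw [hrange]
        rintro ⟨t, ht, h⟩
        refine hs t ht ?_
        rw [h]
        field_simp
        ring
      · rw [div_div]
        congr 1
        field_simp
        ring
    have h1 := hval (-(ε * Complex.I)) fun t ht => by
      simpa only [sub_eq_add_neg] using (hε t ht).1
    have h2 := hval (ε * Complex.I) fun t ht => (hε t ht).2
    by_contra hempty
    rw [Set.not_nonempty_iff_eq_empty, Set.eq_empty_iff_forall_notMem] at hempty
    simp only [Set.mem_ofPred_eq, not_and, not_not] at hempty
    refine hjump ?_
    rw [← h2.2, hempty _ h2.1]
    simp only [sub_eq_add_neg] at h1 ⊢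
    rw [← h1.2]
    exact hempty _ h1.1
  · refine (Metric.isBounded_closedBall (x := (0 : ℂ)) (r := R)).subset fun z hz => ?_
    by_contra hzR
    rw [mem_closedBall_zero_iff, not_le] at hzR
    have hR0 : 0 ≤ R := (norm_nonneg _).trans (hR (c 0) ⟨0, rfl⟩)
    have hz0 : z ≠ 0 := norm_pos_iff.1 (hR0.trans_lt hzR)
    refine hz.2 ?_
    have h0 := intervalIntegral_div_eq_zero_of_norm_sub_one_lt (a := -S) (b := S)
      (u := fun t => (c t - z) / (-z)) (fun t => ((hc t).sub_const z).div_const _)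
      (hc'.div_const _)
      (fun t => by
        rw [div_sub_one (neg_ne_zero.2 hz0), norm_div, norm_neg,
          div_lt_one (norm_pos_iff.2 hz0)]
        simpa using (hR (c t) ⟨t, rfl⟩).trans_lt hzR) (by simp only [hend])
    rw [← h0]
    refine intervalIntegral.integral_congr fun t _ => ?_
    rw [div_div_div_cancel_right₀ (neg_ne_zero.2 hz0)]
  · intro z hz
    by_contra hzc
    obtain ⟨r, hr, h⟩ := hlocal z hzc
    obtain ⟨y, hyD, hy⟩ := Metric.mem_closure_iff.1 hz.1 r hr
    have := h y (by rwa [Metric.mem_ball, dist_comm])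
    exact hz.2 (interior_maximal (fun x hx => Set.mem_ofPred_eq.mpr ⟨(h x hx).1, by
      rw [(h x hx).2, ← this.2]; exact hyD.2⟩) Metric.isOpen_ball (Metric.mem_ball_self hr))
  · rintro z hz ⟨h, -⟩
    exact h hz

theorem abs_le_of_hasDerivAt_of_sub_le {φ : ℝ → ℝ} {l L : ℝ} (hφ : HasDerivAt φ l 0)
    (h : ∀ ε > 0, ∀ᶠ t in nhds 0, φ t - φ 0 ≤ (L + ε) * |t|) : |l| ≤ L := by
  refine le_of_forall_pos_le_add fun ε hε => ?_
  have h1 := (hasDerivAt_iff_isLittleO.1 hφ).def (half_pos hε)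
  obtain ⟨r, hr, hball⟩ := Metric.eventually_nhds_iff.1 (h1.and (h _ (half_pos hε)))
  have hlin : ∀ t, |t| < r → t * l ≤ (L + ε) * |t| := by
    intro t ht
    obtain ⟨h2, h3⟩ := hball (y := t) (by simpa using ht)
    simp only [sub_zero, smul_eq_mul, Real.norm_eq_abs] at h2
    have := (abs_le.1 h2).1
    linarith
  have hr2 : 0 < r / 2 := half_pos hr
  have h4 := hlin (r / 2) (by rw [abs_of_pos hr2]; linarith)
  have h5 := hlin (-(r / 2)) (by rw [abs_neg, abs_of_pos hr2]; linarith)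
  rw [abs_of_pos hr2] at h4
  rw [abs_neg, abs_of_pos hr2] at h5
  rw [abs_le]
  constructor <;> nlinarith

open Metric in
/-- The truncated distance to the complement of a domain bounded by an integral curve of a
Lipschitz field changes slowly along the field. -/
theorem abs_fderiv_min_infDist_compl_le {E : Type*} [NormedAddCommGroup E] [NormedSpace ℝ E]
    [FiniteDimensional ℝ E] {X : E → E} {L : NNReal} (hX : LipschitzWith L X) {D : Set E}
    (hD : D ≠ Set.univ) {γ : ℝ → E} (hγ : ∀ t, HasDerivAt γ (X (γ t)) t)
    (hfr : frontier D ⊆ Set.range γ) (hγD : Set.range γ ⊆ Dᶜ) (k : ℝ) (hk : 0 ≤ k) {z : E}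
    (hz : z ∈ D) (hdiff : DifferentiableAt ℝ (fun w => min 1 (k * infDist w Dᶜ)) z) :
    |fderiv ℝ (fun w => min 1 (k * infDist w Dᶜ)) z (X z)| ≤ L := by
  obtain ⟨y, hy, hzy⟩ := exists_mem_frontier_infDist_compl_eq_dist hz hD
  obtain ⟨s, rfl⟩ := hfr hy
  have hline : HasDerivAt (fun t : ℝ => z + t • X z) (X z) 0 := by
    simpa using ((hasDerivAt_id (0 : ℝ)).smul_const (X z)).const_add z
  have hφ : HasDerivAt (fun t : ℝ => min 1 (k * infDist (z + t • X z) Dᶜ))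
      (fderiv ℝ (fun w => min 1 (k * infDist w Dᶜ)) z (X z)) 0 := by
    have h1 : HasFDerivAt (fun w => min 1 (k * infDist w Dᶜ))
        (fderiv ℝ (fun w => min 1 (k * infDist w Dᶜ)) z) (z + (0 : ℝ) • X z) := by
      simpa using hdiff.hasFDerivAt
    exact h1.comp_hasDerivAt 0 hline
  refine abs_le_of_hasDerivAt_of_sub_le hφ fun ε hε => ?_
  have hshift : HasDerivAt (fun t => γ (s + t)) (X (γ s)) 0 := by
    have h1 : HasDerivAt γ (X (γ s)) (s + 0) := by simpa using hγ s
    simpa using h1.comp_const_add s 0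
  have ho := (hasDerivAt_iff_isLittleO.1 hshift).def (c := ε / (k + 1)) (by positivity)
  filter_upwards [ho] with t ht
  simp only [add_zero, sub_zero, Real.norm_eq_abs] at ht
  simp only [zero_smul, add_zero]
  have hd : infDist (z + t • X z) Dᶜ ≤
      infDist z Dᶜ + |t| * (L * infDist z Dᶜ) + ε / (k + 1) * |t| := by
    calc infDist (z + t • X z) Dᶜ ≤ dist (z + t • X z) (γ (s + t)) :=
          infDist_le_dist_of_mem (hγD ⟨_, rfl⟩)
      _ = ‖(z - γ s) + t • (X z - X (γ s)) - (γ (s + t) - γ s - t • X (γ s))‖ := by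
          rw [dist_eq_norm]
          congr 1
          module
      _ ≤ ‖z - γ s‖ + ‖t • (X z - X (γ s))‖ + ‖γ (s + t) - γ s - t • X (γ s)‖ :=
          (norm_sub_le _ _).trans (add_le_add_left (norm_add_le _ _) _)
      _ ≤ _ := by
          rw [norm_smul, Real.norm_eq_abs, ← dist_eq_norm, ← dist_eq_norm, hzy]
          gcongr
          exact hX.dist_le_mul _ _
  have ht0 := abs_nonneg t
  have hL : (0 : ℝ) ≤ L := L.2
  rcases le_total (k * infDist z Dᶜ) 1 with h | h
  · rw [min_eq_right h, sub_le_iff_le_add]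
    refine (min_le_right _ _).trans ?_
    have h1 : k * (ε / (k + 1)) ≤ ε := by
      rw [mul_div_assoc', div_le_iff₀ (by positivity)]
      nlinarith
    calc k * infDist (z + t • X z) Dᶜ
        ≤ k * (infDist z Dᶜ + |t| * (L * infDist z Dᶜ) + ε / (k + 1) * |t|) := by gcongr
      _ = k * infDist z Dᶜ + (L * |t|) * (k * infDist z Dᶜ) + (k * (ε / (k + 1))) * |t| := by
          ring
      _ ≤ k * infDist z Dᶜ + (L * |t|) * 1 + ε * |t| := by gcongr
      _ = _ := by ring
  · rw [min_eq_left h]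
    have := min_le_left 1 (k * infDist (z + t • X z) Dᶜ)
    have : 0 ≤ (L + ε) * |t| := by positivity
    linarith

open Metric Filter in
/-- The divergence of `b • (p, q)` has integral zero over a bounded domain bounded by an integral
curve of `(p, q)`. -/
theorem setIntegral_divergence_eq_zero {p q b : ℝ × ℝ → ℝ}
    (hp : ContDiff ℝ 1 p) (hps : HasCompactSupport p) (hq : ContDiff ℝ 1 q)
    (hqs : HasCompactSupport q) (hb : ContDiff ℝ 1 b) (hbs : HasCompactSupport b)
    {D : Set (ℝ × ℝ)} (hDo : IsOpen D) (hD : D ≠ Set.univ) {γ : ℝ → ℝ × ℝ}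
    (hγ : ∀ t, HasDerivAt γ (p (γ t), q (γ t)) t)
    (hfr : frontier D ⊆ Set.range γ) (hγD : Set.range γ ⊆ Dᶜ) :
    ∫ z in D, (fderiv ℝ (fun w => b w * p w) z (1, 0) +
      fderiv ℝ (fun w => b w * q w) z (0, 1)) = 0 := by
  obtain ⟨Lp, hLp⟩ := ContDiff.lipschitzWith_of_hasCompactSupport hps hp one_ne_zero
  obtain ⟨Lq, hLq⟩ := ContDiff.lipschitzWith_of_hasCompactSupport hqs hq one_ne_zero
  have hX : LipschitzWith (max Lp Lq) fun z => (p z, q z) := hLp.prodMk hLq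
  have hF₁ : ContDiff ℝ 1 fun w => b w * p w := hb.mul hp
  have hF₂ : ContDiff ℝ 1 fun w => b w * q w := hb.mul hq
  have hs₁ : HasCompactSupport fun w => b w * p w := hps.mul_left
  have hs₂ : HasCompactSupport fun w => b w * q w := hqs.mul_left
  have hlin : ∀ F : ℝ × ℝ → ℝ, ContDiff ℝ 1 F → HasCompactSupport F → ∀ v,
      Integrable fun z => fderiv ℝ F z v := fun F hF hFs v =>
    ((hF.continuous_fderiv one_ne_zero).clm_apply continuous_const).integrable_of_hasCompactSupport
      (hFs.fderiv_apply ℝ v)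
  set χ : ℕ → ℝ × ℝ → ℝ := fun n z => min 1 (n * infDist z Dᶜ) with hχdef
  have hχ0 : ∀ n z, 0 ≤ χ n z := fun n z => le_min zero_le_one 
    (mul_nonneg n.cast_nonneg infDist_nonneg)
  have hχ1 : ∀ n z, χ n z ≤ 1 := fun n z => min_le_left _ _
  have hχz : ∀ n, ∀ z ∉ D, χ n z = 0 := fun n z hz => by
    simp [hχdef, infDist_zero_of_mem (show z ∈ Dᶜ from hz)]
  have hχlip : ∀ n, ∃ C, LipschitzWith C (χ n) := fun n => by
    have h1 : LipschitzWith (n * 1) fun z => (n : ℝ) * infDist z Dᶜ := by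
      refine LipschitzWith.of_dist_le_mul fun x y => ?_
      rw [Real.dist_eq, ← mul_sub, abs_mul, ← Real.dist_eq]
      simpa using mul_le_mul_of_nonneg_left ((lipschitz_infDist_pt Dᶜ).dist_le_mul x y)
        (abs_nonneg (n : ℝ))
    exact ⟨_, h1.const_min 1⟩
  choose C hC using hχlip
  have hχone : ∀ z ∈ D, ∀ᶠ n in atTop, ∀ᶠ w in nhds z, χ n w = 1 := by
    intro z hz
    have hd : 0 < infDist z Dᶜ := by
      rw [← hDo.isClosed_compl.notMem_iff_infDist_pos (Set.nonempty_compl.2 hD)]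
      simpa using hz
    obtain ⟨N, hN⟩ := exists_nat_gt (1 / infDist z Dᶜ)
    filter_upwards [eventually_ge_atTop N] with n hn
    have h1 : 1 < n * infDist z Dᶜ := by
      rw [div_lt_iff₀ hd] at hN
      exact hN.trans_le (by gcongr)
    have hcont : Continuous fun w => (n : ℝ) * infDist w Dᶜ :=
      continuous_const.mul (continuous_infDist_pt _)
    filter_upwards [hcont.continuousAt.eventually (lt_mem_nhds h1)] with w hw
    exact min_eq_left hw.le
  have hfz : ∀ n, ∀ z ∉ D, fderiv ℝ (χ n) z = 0 := fun n z hz =>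
    IsLocalMin.fderiv_eq_zero (Eventually.of_forall fun w => by rw [hχz n z hz]; exact hχ0 n w)
  have hparts : ∀ n (F : ℝ × ℝ → ℝ), ContDiff ℝ 1 F → HasCompactSupport F → ∀ v,
      ∫ z, lineDeriv ℝ (χ n) z v * F z = -∫ z, χ n z * fderiv ℝ F z v := by
    intro n F hF hFs v
    obtain ⟨K, hK⟩ := ContDiff.lipschitzWith_of_hasCompactSupport hFs hF one_ne_zero
    rw [(hC n).integral_lineDeriv_mul_eq hK hFs v, ← integral_neg]
    congr 1 with z
    rw [((hF.differentiable one_ne_zero) z).lineDeriv_eq_fderiv, map_neg]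
    ring
  have hint₁ : ∀ n (F : ℝ × ℝ → ℝ), ContDiff ℝ 1 F → HasCompactSupport F → ∀ v,
      Integrable fun z => lineDeriv ℝ (χ n) z v * F z := fun n F hF hFs v =>
    (hF.continuous.integrable_of_hasCompactSupport hFs).bdd_mul
      (aestronglyMeasurable_lineDeriv (hC n).continuous volume)
      (Eventually.of_forall fun z => norm_lineDeriv_le_of_lipschitz ℝ (hC n))
  have hint₂ : ∀ n (F : ℝ × ℝ → ℝ), ContDiff ℝ 1 F → HasCompactSupport F → ∀ v,
      Integrable fun z => χ n z * fderiv ℝ F z v := fun n F hF hFs v =>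
    (hlin F hF hFs v).bdd_mul (c := 1) (hC n).continuous.aestronglyMeasurable
      (Eventually.of_forall fun z => by
        rw [Real.norm_of_nonneg (hχ0 n z)]; exact hχ1 n z)
  set G : ℕ → ℝ × ℝ → ℝ := fun n z =>
    lineDeriv ℝ (χ n) z (1, 0) * (b z * p z) + lineDeriv ℝ (χ n) z (0, 1) * (b z * q z) with hG
  set div : ℝ × ℝ → ℝ := fun z => fderiv ℝ (fun w => b w * p w) z (1, 0) +
      fderiv ℝ (fun w => b w * q w) z (0, 1) with hdiv
  have hGdiv : ∀ n, ∫ z, G n z = -∫ z, χ n z * div z := by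
    intro n
    simp only [hG, hdiv, mul_add]
    rw [integral_add (hint₁ n _ hF₁ hs₁ _) (hint₁ n _ hF₂ hs₂ _),
      integral_add (hint₂ n _ hF₁ hs₁ _) (hint₂ n _ hF₂ hs₂ _),
      hparts n _ hF₁ hs₁, hparts n _ hF₂ hs₂]
    ring
  have hdivint : Integrable div := (hlin _ hF₁ hs₁ _).add (hlin _ hF₂ hs₂ _)
  have hlimdiv : Tendsto (fun n => ∫ z, χ n z * div z) atTop (nhds (∫ z in D, div z)) := by
    rw [← integral_indicator hDo.measurableSet]
    refine tendsto_integral_of_dominated_convergence (fun z => ‖div z‖)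
      (fun n => (hC n).continuous.aestronglyMeasurable.mul hdivint.aestronglyMeasurable)
      hdivint.norm (fun n => Eventually.of_forall fun z => ?_) (Eventually.of_forall fun z => ?_)
    · rw [norm_mul, Real.norm_of_nonneg (hχ0 n z)]
      exact mul_le_of_le_one_left (norm_nonneg _) (hχ1 n z)
    · refine tendsto_const_nhds.congr' ?_
      by_cases hz : z ∈ D
      · filter_upwards [hχone z hz] with n hn
        rw [hn.self_of_nhds, one_mul, Set.indicator_of_mem hz]
      · refine Eventually.of_forall fun n => ?_
        beta_reduce
        rw [hχz n z hz, zero_mul, Set.indicator_of_notMem hz]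
  have hdiffae : ∀ᵐ z, ∀ n, DifferentiableAt ℝ (χ n) z :=
    ae_all_iff.2 fun n => (hC n).ae_differentiableAt
  have hGeq : ∀ n z, DifferentiableAt ℝ (χ n) z →
      G n z = b z * fderiv ℝ (χ n) z (p z, q z) := by
    intro n z hz
    have : ((p z, q z) : ℝ × ℝ) = p z • ((1, 0) : ℝ × ℝ) + q z • ((0, 1) : ℝ × ℝ) := by simp
    simp only [hG]
    rw [hz.lineDeriv_eq_fderiv, hz.lineDeriv_eq_fderiv, this, map_add, map_smul, map_smul,
      smul_eq_mul, smul_eq_mul]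
    ring
  have hlimG : Tendsto (fun n => ∫ z, G n z) atTop (nhds (∫ _ : ℝ × ℝ, (0 : ℝ))) := by
    refine tendsto_integral_of_dominated_convergence (fun z => |b z| * (max Lp Lq : NNReal))
      (fun n => ((hint₁ n _ hF₁ hs₁ _).add (hint₁ n _ hF₂ hs₂ _)).aestronglyMeasurable)
      ((hb.continuous.integrable_of_hasCompactSupport hbs).norm.mul_const _) (fun n => ?_) ?_
    · filter_upwards [hdiffae] with z hz
      rw [hGeq n z (hz n), norm_mul, Real.norm_eq_abs]
      by_cases hzD : z ∈ D
      · gcongr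
        exact abs_fderiv_min_infDist_compl_le hX hD hγ hfr hγD n n.cast_nonneg hzD (hz n)
      · rw [hfz n z hzD]
        simp only [_root_.zero_apply, norm_zero, mul_zero]
        positivity
    · filter_upwards [hdiffae] with z hz
      refine tendsto_const_nhds.congr' ?_
      by_cases hzD : z ∈ D
      · filter_upwards [hχone z hzD] with n hn
        have h0 : fderiv ℝ (χ n) z = 0 := by
          rw [EventuallyEq.fderiv_eq (f₁ := χ n) (f := fun _ => (1 : ℝ)) hn]
          simp
        rw [hGeq n z (hz n), h0]
        simp
      · refine Eventually.of_forall fun n => ?_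
        beta_reduce
        rw [hGeq n z (hz n), hfz n z hzD]
        simp
  simp only [hGdiv, integral_zero] at hlimG
  have := tendsto_nhds_unique hlimG hlimdiv.neg
  linarith

theorem exists_pos_period_forall_ne {E : Type*} [NormedAddCommGroup E] [NormedSpace ℝ E]
    {X : E → E} {L : NNReal} (hX : LipschitzWith L X) {γ : ℝ → E}
    (hγ : ∀ t, HasDerivAt γ (X (γ t)) t) {T : ℝ} (hT : 0 < T) (hper : Function.Periodic γ T)
    (h0 : X (γ 0) ≠ 0) :
    ∃ τ > 0, Function.Periodic γ τ ∧ ∀ t ∈ Set.Ioo 0 τ, γ t ≠ γ 0 := by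
  have hγc : Continuous γ := continuous_iff_continuousAt.2 fun t => (hγ t).continuousAt
  have hne : ∀ᶠ t in nhdsWithin 0 {(0 : ℝ)}ᶜ, γ t ≠ γ 0 := (hγ 0).eventually_ne h0
  obtain ⟨δ, hδ, hball⟩ := Metric.eventually_nhds_iff.1 (eventually_nhdsWithin_iff.1 hne)
  have hsmall : ∀ t, 0 < t → t < δ → γ t ≠ γ 0 := fun t h1 h2 =>
    hball (by rw [Real.dist_eq, sub_zero, abs_of_pos h1]; exact h2) h1.ne'
  have hγT : γ T = γ 0 := by simpa using hper 0
  have hδT : δ ≤ T := by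
    by_contra! h
    exact hsmall T hT h hγT
  have hcomp : IsCompact (Set.Icc δ T ∩ {t | γ t = γ 0}) :=
    isCompact_Icc.inter_right (isClosed_eq hγc continuous_const)
  obtain ⟨τ, ⟨hτ, hγτ⟩, hmin⟩ := hcomp.exists_isLeast ⟨T, ⟨hδT, le_rfl⟩, hγT⟩
  refine ⟨τ, hδ.trans_le hτ.1, fun t => ?_, fun t ht h => ?_⟩
  · have huniq : (fun t => γ (t + τ)) = γ :=
      ODE_solution_unique_univ (v := fun _ => X) (s := fun _ => Set.univ) (K := L) (t₀ := 0)
        (fun _ => hX.lipschitzOnWith) (fun t => ⟨(hγ (t + τ)).comp_add_const t τ, trivial⟩)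
        (fun t => ⟨hγ t, trivial⟩) (by simpa using hγτ)
    exact congrFun huniq t
  · have h1 : δ ≤ t := by
      by_contra! h2
      exact hsmall t ht.1 h2 h
    exact absurd (hmin ⟨⟨h1, ht.2.le.trans hτ.2⟩, h⟩) (not_le.2 ht.2)

/-- A periodic orbit of a Lipschitz planar field in a simply connected region `Ω` encloses a
nonempty bounded open subset of `Ω`. -/
theorem exists_isOpen_subset_frontier_subset_range {Ω : Set (ℝ × ℝ)} (hΩo : IsOpen Ω)
    (hΩ : IsSimplyConnected Ω) {X : ℝ × ℝ → ℝ × ℝ} {L : NNReal} (hX : LipschitzWith L X)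
    {γ : ℝ → ℝ × ℝ} (hγ : ∀ t, HasDerivAt γ (X (γ t)) t) {T : ℝ} (hT : 0 < T)
    (hper : Function.Periodic γ T) (h0 : X (γ 0) ≠ 0) (hγΩ : ∀ t, γ t ∈ Ω) :
    ∃ D ⊆ Ω, IsOpen D ∧ D.Nonempty ∧ Bornology.IsBounded D ∧ frontier D ⊆ Set.range γ ∧
      Set.range γ ⊆ Dᶜ := by
  obtain ⟨τ, hτ, hτper, hsimple⟩ := exists_pos_period_forall_ne hX hγ hT hper h0
  have hγc : Continuous γ := continuous_iff_continuousAt.2 fun t => (hγ t).continuousAt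
  set e : (ℝ × ℝ) ≃L[ℝ] ℂ := Complex.equivRealProdCLM.symm
  have hc : ∀ t, HasDerivAt (fun t => e (γ t)) (e (X (γ t))) t := fun t =>
    e.hasFDerivAt.comp_hasDerivAt t (hγ t)
  have hc' : Continuous fun t => e (X (γ t)) := e.continuous.comp (hX.continuous.comp hγc)
  obtain ⟨D, hDo, ⟨z₀, hz₀⟩, hDb, hfr, hcD, hwind⟩ := exists_isOpen_logIntegral_ne_zero
    (half_pos hτ) hc hc' (by simpa using h0)
    (fun t => by rw [mul_div_cancel₀ τ two_ne_zero]; exact congrArg e (hτper t))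
    (fun t ht hne h => by
      have h1 := e.injective h
      rcases hne.lt_or_gt with h2 | h2
      · exact hsimple (t + τ) ⟨by linarith [ht.1], by linarith⟩ ((hτper t).trans h1)
      · exact hsimple t ⟨h2, by linarith [ht.2]⟩ h1)
  refine ⟨e ⁻¹' D, fun z hz => ?_, hDo.preimage e.continuous,
    ⟨e.symm z₀, by simpa using hz₀⟩, ?_, ?_, ?_⟩
  · by_contra hzΩ
    obtain ⟨f, hfc, hf⟩ := Complex.exists_continuousOn_eqOn_exp_comp hΩ hΩo
      (g := fun w => e w - e z) (by fun_prop) (by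
        rintro ⟨w, hw, h⟩
        exact hzΩ (e.injective (sub_eq_zero.1 h) ▸ hw))
    refine hwind (e z) hz ?_
    refine intervalIntegral_div_eq_zero_of_exp_eq (f := fun t => f (γ t))
      (fun t => (hc t).sub_const (e z)) hc' (hfc.comp_continuous hγc hγΩ)
      (fun t => hf (hγΩ t)) ?_
    rw [← hτper (-(τ / 2))]
    ring_nf
  · have := e.symm.lipschitz.isBounded_image hDb
    rwa [e.symm.image_eq_preimage_symm, e.symm_symm] at this
  · have := e.toHomeomorph.preimage_frontier D
    rintro z hz
    have hz' : z ∈ e ⁻¹' frontier D := by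
      have h1 : z ∈ frontier (e.toHomeomorph ⁻¹' D) := hz
      rwa [← this] at h1
    obtain ⟨t, ht⟩ := hfr hz'
    exact ⟨t, e.injective ht⟩
  · rintro _ ⟨t, rfl⟩
    exact hcD ⟨t, rfl⟩

/-- **Dulac criterion, almost-everywhere version.** Let `Ω ⊆ ℝ²` be an open,
simply connected region, `X = (P, Q)` a `C¹` vector field on `Ω`, `B : Ω → ℝ`
a `C¹` function and `g : Ω → ℝ` continuous with `div (B • X) = g` on `Ω` and
`g > 0` on `Ω` outside a set of Lebesgue measure zero. Then the planar ODE
`x' = P, y' = Q` has no periodic orbit entirely contained in `Ω`. -/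
theorem dulac_criterion_ae
    (Ω : Set (ℝ × ℝ)) (hΩopen : IsOpen Ω) (hΩsc : SimplyConnectedSpace Ω)
    (P Q B g : ℝ × ℝ → ℝ)
    (hP : ContDiffOn ℝ 1 P Ω) (hQ : ContDiffOn ℝ 1 Q Ω)
    (hB : ContDiffOn ℝ 1 B Ω) (hg : ContinuousOn g Ω)
    (hdiv : ∀ z ∈ Ω,
      fderiv ℝ (fun w => B w * P w) z (1, 0) +
        fderiv ℝ (fun w => B w * Q w) z (0, 1) = g z)
    (hgpos : ∃ N : Set (ℝ × ℝ), volume N = 0 ∧ ∀ z ∈ Ω \ N, 0 < g z) :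
    ¬ ∃ (γ : ℝ → ℝ × ℝ) (T : ℝ), 0 < T ∧
        (∀ t, HasDerivAt γ (P (γ t), Q (γ t)) t) ∧
        (∀ t, γ (t + T) = γ t) ∧
        (∃ t₁ t₂, γ t₁ ≠ γ t₂) ∧
        (∀ t, γ t ∈ Ω) := by
  rintro ⟨γ, T, hT, hγ, hper, ⟨t₁, t₂, hne⟩, hγΩ⟩
  obtain ⟨N, hN, hpos⟩ := hgpos
  have hγc : Continuous γ := continuous_iff_continuousAt.2 fun t => (hγ t).continuousAt
  have hcomp : IsCompact (Set.range γ) := by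
    rw [← Function.Periodic.image_Icc hper hT 0]
    exact isCompact_Icc.image hγc
  have hrange : Set.range γ ⊆ Ω := Set.range_subset_iff.2 hγΩ
  obtain ⟨t₀, ht₀⟩ : ∃ t₀, (P (γ t₀), Q (γ t₀)) ≠ 0 := by
    by_contra! h
    exact hne (is_const_of_deriv_eq_zero (fun t => (hγ t).differentiableAt)
      (fun t => (hγ t).deriv.trans (h t)) t₁ t₂)
  obtain ⟨D, hDΩ, hDo, hDne, hDb, hfr, hγD⟩ : ∃ D ⊆ Ω, IsOpen D ∧ D.Nonempty ∧
      Bornology.IsBounded D ∧ frontier D ⊆ Set.range γ ∧ Set.range γ ⊆ Dᶜ := by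
    obtain ⟨p, hp, hps, hpP⟩ := exists_contDiff_hasCompactSupport_eqOn hΩopen hcomp hrange hP
    obtain ⟨q, hq, hqs, hqQ⟩ := exists_contDiff_hasCompactSupport_eqOn hΩopen hcomp hrange hQ
    obtain ⟨Lp, hLp⟩ := ContDiff.lipschitzWith_of_hasCompactSupport hps hp one_ne_zero
    obtain ⟨Lq, hLq⟩ := ContDiff.lipschitzWith_of_hasCompactSupport hqs hq one_ne_zero
    have hX : ∀ t, (p (γ t), q (γ t)) = (P (γ t), Q (γ t)) := fun t => by
      rw [hpP ⟨t, rfl⟩, hqQ ⟨t, rfl⟩]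
    have hshift : Set.range (fun t => γ (t + t₀)) = Set.range γ :=
      (Equiv.addRight t₀).surjective.range_comp γ
    have := exists_isOpen_subset_frontier_subset_range hΩopen
      hΩsc (hLp.prodMk hLq)
      (γ := fun t => γ (t + t₀))
      (fun t => by simpa only [hX] using (hγ (t + t₀)).comp_add_const t t₀) hT
      (fun t => by simpa only [add_right_comm] using hper (t + t₀))
      (by simpa only [hX, zero_add] using ht₀) (fun t => hγΩ _)
    rwa [hshift] at this
  have hclosure : closure D ⊆ Ω := by
    rw [closure_eq_self_union_frontier]
    exact Set.union_subset hDΩ (hfr.trans hrange)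
  have hDc : IsCompact (closure D) := hDb.isCompact_closure
  have hK : IsCompact (Set.range γ ∪ closure D) := hcomp.union hDc
  have hKΩ : Set.range γ ∪ closure D ⊆ Ω := Set.union_subset hrange hclosure
  obtain ⟨p, hp, hps, hpP⟩ := exists_contDiff_hasCompactSupport_eqOn hΩopen hK hKΩ hP
  obtain ⟨q, hq, hqs, hqQ⟩ := exists_contDiff_hasCompactSupport_eqOn hΩopen hK hKΩ hQ
  obtain ⟨b, hb, hbs, hbB⟩ := exists_contDiff_hasCompactSupport_eqOn hΩopen hK hKΩ hB
  have hzero := setIntegral_divergence_eq_zero hp hps hq hqs hb hbs hDo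
    (fun h => hγD ⟨t₀, rfl⟩ (h ▸ Set.mem_univ _))
    (fun t => by rw [hpP (Or.inl ⟨t, rfl⟩), hqQ (Or.inl ⟨t, rfl⟩)]; exact hγ t) hfr hγD
  have hgzero : ∫ z in D, g z = 0 := by
    rw [← hzero]
    refine setIntegral_congr_fun hDo.measurableSet fun z hz => ?_
    have hnear : ∀ᶠ w in nhds z, w ∈ Set.range γ ∪ closure D :=
      Filter.mem_of_superset (hDo.mem_nhds hz) fun w hw => Or.inr (subset_closure hw)
    have h1 : (fun w => b w * p w) =ᶠ[nhds z] fun w => B w * P w := by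
      filter_upwards [hnear] with w hw
      rw [hbB hw, hpP hw]
    have h2 : (fun w => b w * q w) =ᶠ[nhds z] fun w => B w * Q w := by
      filter_upwards [hnear] with w hw
      rw [hbB hw, hqQ hw]
    rw [h1.fderiv_eq, h2.fderiv_eq, hdiv z (hDΩ hz)]
  have hgint : IntegrableOn g D :=
    ((hg.mono hclosure).integrableOn_compact hDc).mono_set subset_closure
  have hNae : ∀ᵐ z, z ∉ N := measure_eq_zero_iff_ae_notMem.1 hN
  have hgnonneg : 0 ≤ᵐ[volume.restrict D] g := by
    filter_upwards [ae_restrict_mem hDo.measurableSet, ae_restrict_of_ae hNae] with z hz hzN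
    exact (hpos z ⟨hDΩ hz, hzN⟩).le
  refine (((setIntegral_pos_iff_support_of_nonneg_ae hgnonneg hgint).2 ?_).ne' hgzero)
  calc 0 < volume D := hDo.measure_pos volume hDne
    _ = volume (D \ N) := (measure_sdiff_null hN).symm
    _ ≤ volume (Function.support g ∩ D) := measure_mono fun z hz => ⟨(hpos z ⟨hDΩ hz.1, hz.2⟩).ne', hz.1⟩
end

section
/- Let X : ℝ² → ℝ² be a C¹ vector field and let z₀ be a hyperbolic zero of X, i.e. X(z₀) = 0 and every eigenvalue of the Jacobian matrix DX(z₀) has nonzero real part. Then there exist an open neighborhood U of z₀, a C¹ function B : U → ℝ, and a continuous function g : U → ℝ with g(z) > 0 for all z ∈ U outside a set of Lebesgue measure zero, such that div(B·X) = g on U; that is, X has a Dulac function on U. -/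
open MeasureTheory

/-- The product rule `div (B • X) = ∇B · X + B div X` for `X = (P, Q)`. -/
theorem divergence_mul {B P Q : ℝ × ℝ → ℝ} {z : ℝ × ℝ} (hB : DifferentiableAt ℝ B z)
    (hP : DifferentiableAt ℝ P z) (hQ : DifferentiableAt ℝ Q z) :
    fderiv ℝ (fun w => B w * P w) z (1, 0) + fderiv ℝ (fun w => B w * Q w) z (0, 1) =
      fderiv ℝ B z (1, 0) * P z + fderiv ℝ B z (0, 1) * Q z +
        B z * (fderiv ℝ P z (1, 0) + fderiv ℝ Q z (0, 1)) := by
  rw [fderiv_fun_mul hB hP, fderiv_fun_mul hB hQ]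
  simp only [add_apply, smul_apply, smul_eq_mul]
  ring

/-- A `C¹` function which makes the divergence of `B • X` positive near `z₀`, except possibly at
`z₀`, yields a Dulac function of `X = (P, Q)` in a neighborhood of `z₀`. -/
theorem exists_dulac_of_eventually_pos {B P Q : ℝ × ℝ → ℝ} (hB : ContDiff ℝ 1 B)
    (hP : ContDiff ℝ 1 P) (hQ : ContDiff ℝ 1 Q) {z₀ : ℝ × ℝ}
    (hpos : ∀ᶠ z in nhds z₀, z ≠ z₀ →
      0 < fderiv ℝ B z (1, 0) * P z + fderiv ℝ B z (0, 1) * Q z +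
        B z * (fderiv ℝ P z (1, 0) + fderiv ℝ Q z (0, 1))) :
    ∃ U : Set (ℝ × ℝ), IsOpen U ∧ z₀ ∈ U ∧
      ∃ (B g : ℝ × ℝ → ℝ), ContDiffOn ℝ 1 B U ∧ ContinuousOn g U ∧
        (∃ N : Set (ℝ × ℝ), volume N = 0 ∧ ∀ z ∈ U \ N, 0 < g z) ∧
        ∀ z ∈ U,
          fderiv ℝ (fun w => B w * P w) z (1, 0) +
            fderiv ℝ (fun w => B w * Q w) z (0, 1) = g z := by
  obtain ⟨U, hU, hUo, hz⟩ := eventually_nhds_iff.1 hpos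
  refine ⟨U, hUo, hz, B, _, hB.contDiffOn, Continuous.continuousOn ?_,
    ⟨{z₀}, measure_singleton z₀, fun z hzU => hU z hzU.1 hzU.2⟩, fun z _ =>
      divergence_mul (hB.differentiable one_ne_zero z) (hP.differentiable one_ne_zero z)
        (hQ.differentiable one_ne_zero z)⟩
  have hB' := hB.continuous_fderiv one_ne_zero
  have hP' := hP.continuous_fderiv one_ne_zero
  have hQ' := hQ.continuous_fderiv one_ne_zero
  have := hB.continuous
  have := hP.continuous
  have := hQ.continuous
  fun_prop

/-- A real traceless `2 × 2` matrix without purely imaginary eigenvalues has negative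
determinant. -/
theorem traceless_hyperbolic_pos {a b c : ℝ}
    (h : ∀ μ ∈ spectrum ℂ ((!![a, b; c, -a]).map Complex.ofReal), μ.re ≠ 0) :
    0 < a ^ 2 + b * c := by
  by_contra! hle
  obtain ⟨s, hs⟩ : ∃ s : ℝ, s ^ 2 = -(a ^ 2 + b * c) :=
    ⟨√(-(a ^ 2 + b * c)), Real.sq_sqrt (by linarith)⟩
  refine h (Complex.I * s) ?_ (by simp)
  rw [spectrum.mem_iff, Matrix.isUnit_iff_isUnit_det, isUnit_iff_ne_zero, not_not,
    Matrix.det_fin_two]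
  have hs' : (s : ℂ) ^ 2 = -(a ^ 2 + b * c) := mod_cast hs
  simp only [Matrix.sub_apply, Matrix.algebraMap_matrix_apply]
  simp
  linear_combination Complex.I ^ 2 * hs' - (a ^ 2 + b * c : ℂ) * Complex.I_sq

/-- Derivatives of the quadratic form `w ↦ ⟪w - z₀, A (w - z₀)⟫` with `A = !![a, b; c, -a]`. -/
theorem hasFDerivAt_quadratic (a b c : ℝ) (z₀ z : ℝ × ℝ) :
    HasFDerivAt (fun w : ℝ × ℝ => a * (w.1 - z₀.1) ^ 2 +
        (b + c) * ((w.1 - z₀.1) * (w.2 - z₀.2)) - a * (w.2 - z₀.2) ^ 2)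
      ((2 * a * (z.1 - z₀.1) + (b + c) * (z.2 - z₀.2)) • ContinuousLinearMap.fst ℝ ℝ ℝ +
        ((b + c) * (z.1 - z₀.1) - 2 * a * (z.2 - z₀.2)) • ContinuousLinearMap.snd ℝ ℝ ℝ) z := by
  have h1 : HasFDerivAt (fun w : ℝ × ℝ => w.1 - z₀.1) (ContinuousLinearMap.fst ℝ ℝ ℝ) z :=
    hasFDerivAt_fst.sub_const _
  have h2 : HasFDerivAt (fun w : ℝ × ℝ => w.2 - z₀.2) (ContinuousLinearMap.snd ℝ ℝ ℝ) z :=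
    hasFDerivAt_snd.sub_const _
  refine ((((h1.pow 2).const_mul a).add ((h1.mul h2).const_mul (b + c))).sub
    ((h2.pow 2).const_mul a)).congr_fderiv ?_
  ext <;> simp <;> ring

/-- The quadratic estimate behind the saddle case: `p`, `q` approximate the linear field with
matrix `!![a, b; c, -a]` at `(u, v)` and `t` is the divergence. -/
theorem saddle_estimate {a b c u v p q t m ε : ℝ} (hu : |u| ≤ m) (hv : |v| ≤ m)
    (hm : m ^ 2 ≤ u ^ 2 + v ^ 2) (hm0 : 0 < m)
    (hε : 6 * (|a| + |b| + |c|) * ε < a ^ 2 + b * c)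
    (hp : |p - (a * u + b * v)| ≤ ε * m) (hq : |q - (c * u - a * v)| ≤ ε * m) (ht : |t| ≤ ε)
    (hD : 0 < a ^ 2 + b * c) :
    0 < (2 * a * u + (b + c) * v) * p + ((b + c) * u - 2 * a * v) * q +
      (a * u ^ 2 + (b + c) * (u * v) - a * v ^ 2) * t := by
  set K := |a| + |b| + |c| with hK
  have hbc : |b + c| ≤ |b| + |c| := abs_add_le b c
  have ha := abs_nonneg a
  have hb := abs_nonneg b
  have hc := abs_nonneg c
  have hx : |2 * a * u + (b + c) * v| ≤ 2 * K * m := by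
    calc |2 * a * u + (b + c) * v| ≤ |2 * a * u| + |(b + c) * v| := abs_add_le _ _
      _ = 2 * |a| * |u| + |b + c| * |v| := by simp [abs_mul]
      _ ≤ 2 * |a| * m + (|b| + |c|) * m := by gcongr
      _ ≤ 2 * K * m := by rw [hK]; nlinarith
  have hy : |(b + c) * u - 2 * a * v| ≤ 2 * K * m := by
    calc |(b + c) * u - 2 * a * v| ≤ |(b + c) * u| + |2 * a * v| := abs_sub _ _
      _ = |b + c| * |u| + 2 * |a| * |v| := by simp [abs_mul]
      _ ≤ (|b| + |c|) * m + 2 * |a| * m := by gcongr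
      _ ≤ 2 * K * m := by rw [hK]; nlinarith
  have hB : |a * u ^ 2 + (b + c) * (u * v) - a * v ^ 2| ≤ 2 * K * m ^ 2 := by
    calc |a * u ^ 2 + (b + c) * (u * v) - a * v ^ 2|
        ≤ |a * u ^ 2| + |(b + c) * (u * v)| + |a * v ^ 2| :=
          (abs_sub _ _).trans (by gcongr; exact abs_add_le _ _)
      _ = |a| * |u| ^ 2 + |b + c| * (|u| * |v|) + |a| * |v| ^ 2 := by simp [abs_mul]
      _ ≤ |a| * m ^ 2 + (|b| + |c|) * (m * m) + |a| * m ^ 2 := by gcongr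
      _ ≤ 2 * K * m ^ 2 := by
          rw [hK]
          nlinarith [mul_nonneg hb (sq_nonneg m), mul_nonneg hc (sq_nonneg m)]
  have hKm : 0 ≤ 2 * K * m := (abs_nonneg _).trans hx
  have hKm2 : 0 ≤ 2 * K * m ^ 2 := (abs_nonneg _).trans hB
  have e1 := neg_le_of_abs_le ((abs_mul _ _).trans_le (mul_le_mul hx hp (abs_nonneg _) hKm))
  have e2 := neg_le_of_abs_le ((abs_mul _ _).trans_le (mul_le_mul hy hq (abs_nonneg _) hKm))
  have e3 := neg_le_of_abs_le ((abs_mul _ _).trans_le (mul_le_mul hB ht (abs_nonneg _) hKm2))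
  have hgap := mul_pos (sub_pos.2 hε) (pow_pos hm0 2)
  have hmain := mul_le_mul_of_nonneg_left hm hD.le
  nlinarith [sq_nonneg (a * u + b * v), sq_nonneg (c * u - a * v)]

/-- **Dulac functions near hyperbolic fixed points.** Let `X = (P, Q)` be a
`C¹` vector field on `ℝ²` and `z₀` a hyperbolic zero of `X`, i.e. `X z₀ = 0`
and every complex eigenvalue of the Jacobian `DX(z₀)` has nonzero real part.
Then there are an open neighborhood `U` of `z₀`, a `C¹` function `B : U → ℝ`
and a continuous `g : U → ℝ`, positive on `U` outside a Lebesgue null set,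
with `div (B • X) = g` on `U`; i.e. `X` has a Dulac function on `U`. -/
theorem dulac_function_near_hyperbolic_zero
    (P Q : ℝ × ℝ → ℝ) (hP : ContDiff ℝ 1 P) (hQ : ContDiff ℝ 1 Q)
    (z₀ : ℝ × ℝ) (hzero : P z₀ = 0 ∧ Q z₀ = 0)
    (hhyp : ∀ μ ∈ spectrum ℂ
        ((!![fderiv ℝ P z₀ (1, 0), fderiv ℝ P z₀ (0, 1);
             fderiv ℝ Q z₀ (1, 0), fderiv ℝ Q z₀ (0, 1)]).map Complex.ofReal),
      μ.re ≠ 0) :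
    ∃ U : Set (ℝ × ℝ), IsOpen U ∧ z₀ ∈ U ∧
      ∃ (B g : ℝ × ℝ → ℝ), ContDiffOn ℝ 1 B U ∧ ContinuousOn g U ∧
        (∃ N : Set (ℝ × ℝ), volume N = 0 ∧ ∀ z ∈ U \ N, 0 < g z) ∧
        ∀ z ∈ U,
          fderiv ℝ (fun w => B w * P w) z (1, 0) +
            fderiv ℝ (fun w => B w * Q w) z (0, 1) = g z := by
  by_cases hT : fderiv ℝ P z₀ (1, 0) + fderiv ℝ Q z₀ (0, 1) = 0
  · set a := fderiv ℝ P z₀ (1, 0) with ha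
    set b := fderiv ℝ P z₀ (0, 1) with hb
    set c := fderiv ℝ Q z₀ (1, 0) with hc
    have hd : fderiv ℝ Q z₀ (0, 1) = -a := by linarith
    rw [hd] at hhyp
    have hD := traceless_hyperbolic_pos hhyp
    have hlin : ∀ (L : ℝ × ℝ →L[ℝ] ℝ) (w : ℝ × ℝ), L w = L (1, 0) * w.1 + L (0, 1) * w.2 := by
      intro L w
      conv_lhs => rw [show w = w.1 • ((1, 0) : ℝ × ℝ) + w.2 • ((0, 1) : ℝ × ℝ) by ext <;> simp]
      rw [map_add, map_smul, map_smul, smul_eq_mul, smul_eq_mul]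
      ring
    obtain ⟨ε, hε0, hε⟩ : ∃ ε : ℝ, 0 < ε ∧ 6 * (|a| + |b| + |c|) * ε < a ^ 2 + b * c := by
      have hK : 0 < 6 * (|a| + |b| + |c|) + 1 := by positivity
      refine ⟨(a ^ 2 + b * c) / (6 * (|a| + |b| + |c|) + 1), by positivity, ?_⟩
      rw [← mul_div_assoc, div_lt_iff₀ hK]
      nlinarith
    refine exists_dulac_of_eventually_pos (B := fun w : ℝ × ℝ => a * (w.1 - z₀.1) ^ 2 +
      (b + c) * ((w.1 - z₀.1) * (w.2 - z₀.2)) - a * (w.2 - z₀.2) ^ 2) (by fun_prop) hP hQ ?_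
    have hPl := (hP.differentiable one_ne_zero z₀).hasFDerivAt.isLittleO.def hε0
    have hQl := (hQ.differentiable one_ne_zero z₀).hasFDerivAt.isLittleO.def hε0
    have hdiv : ∀ᶠ z in nhds z₀, |fderiv ℝ P z (1, 0) + fderiv ℝ Q z (0, 1)| < ε := by
      have hP' := hP.continuous_fderiv one_ne_zero
      have hQ' := hQ.continuous_fderiv one_ne_zero
      have hcont : Continuous fun z => |fderiv ℝ P z (1, 0) + fderiv ℝ Q z (0, 1)| := by fun_prop
      exact hcont.continuousAt.eventually_lt_const (by simpa [← ha, hT] using hε0)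
    filter_upwards [hPl, hQl, hdiv] with z hp hq ht hne
    rw [hzero.1, sub_zero, hlin, ← ha, ← hb, Real.norm_eq_abs] at hp
    rw [hzero.2, sub_zero, hlin, ← hc, hd, Real.norm_eq_abs, neg_mul, ← sub_eq_add_neg] at hq
    rw [(hasFDerivAt_quadratic a b c z₀ z).fderiv]
    have hm : ‖z - z₀‖ ^ 2 ≤ (z.1 - z₀.1) ^ 2 + (z.2 - z₀.2) ^ 2 := by
      rw [Prod.norm_def]
      rcases max_choice ‖(z - z₀).1‖ ‖(z - z₀).2‖ with h | h <;> rw [h] <;>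
        simp only [Real.norm_eq_abs, sq_abs, Prod.fst_sub, Prod.snd_sub] <;>
        nlinarith [sq_nonneg (z.1 - z₀.1), sq_nonneg (z.2 - z₀.2)]
    simpa using saddle_estimate (norm_fst_le (z - z₀)) (norm_snd_le (z - z₀)) hm
      (norm_pos_iff.2 (sub_ne_zero.2 hne)) hε hp hq ht.le hD
  · set T := fderiv ℝ P z₀ (1, 0) + fderiv ℝ Q z₀ (0, 1) with hTdef
    refine exists_dulac_of_eventually_pos (B := fun _ => T) contDiff_const hP hQ ?_
    have hP' := hP.continuous_fderiv one_ne_zero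
    have hQ' := hQ.continuous_fderiv one_ne_zero
    have hcont : Continuous fun z => T * (fderiv ℝ P z (1, 0) + fderiv ℝ Q z (0, 1)) := by
      fun_prop
    filter_upwards [hcont.continuousAt.eventually_const_lt (mul_self_pos.2 hT)] with z hz _
    simpa using hz
end
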